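/- Let G be a torsion-free, finitely presented CSA group. Let 𝒮 be the collection of slender subgroups of G and let 𝒜 be the collection of abelian subgroups of G. Let T_𝒮 be a JSJ tree of G over 𝒮, and let π : T_𝒮 → T be a collapse map whose collapsed edges are exactly the edges of T_𝒮 with non-abelian stabilizer. Then T is a JSJ tree of G over 𝒜. -/

import Mathlib

universe u v

/-- A `G`-tree: a nonempty simple graph which is a tree (connected and acyclic),
with a minimal action of `G` by graph automorphisms without inversions. -/
structure GTree (G : Type u) [Group G] : Type (u + 1) where
  V : Type u
  graph : SimpleGraph V
  nonempty : Nonempty V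
  connected : graph.Connected
  acyclic : graph.IsAcyclic
  act : G → V → V
  act_one : ∀ w, act 1 w = w
  act_mul : ∀ g h w, act (g * h) w = act g (act h w)
  act_adj : ∀ g a b, graph.Adj a b → graph.Adj (act g a) (act g b)
  noInversion : ∀ g a b, graph.Adj a b → ¬(act g a = b ∧ act g b = a)
  minimal : ∀ S : Set V, S.Nonempty → (∀ g, ∀ w ∈ S, act g w ∈ S) →
    (graph.induce S).Connected → S = Set.univ

namespace GTree

variable {G : Type u} [Group G]

/-- The stabilizer of a vertex. -/
def vertexStab (T : GTree G) (w : T.V) : Subgroup G where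
  carrier := {g | T.act g w = w}
  one_mem' := T.act_one w
  mul_mem' := by
    intro a b ha hb
    simp only [Set.mem_setOf_eq] at *
    rw [T.act_mul, hb, ha]
  inv_mem' := by
    intro a ha
    simp only [Set.mem_setOf_eq] at *
    calc T.act a⁻¹ w = T.act a⁻¹ (T.act a w) := by rw [ha]
    _ = T.act (a⁻¹ * a) w := (T.act_mul _ _ _).symm
    _ = w := by rw [inv_mul_cancel, T.act_one]

/-- The stabilizer of an edge `{u,v}`: elements fixing both endpoints. -/
def edgeStab (T : GTree G) (a b : T.V) : Subgroup G :=
  T.vertexStab a ⊓ T.vertexStab b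

/-- A subgroup is elliptic in `T` if it fixes a vertex. -/
def EllipticSubgroup (T : GTree G) (H : Subgroup G) : Prop :=
  ∃ w : T.V, ∀ h ∈ H, T.act h w = w

/-- An element is elliptic in `T` if it fixes a vertex (otherwise it is hyperbolic). -/
def EllipticElt (T : GTree G) (g : G) : Prop :=
  ∃ w : T.V, T.act g w = w

/-- `T₁` dominates `T₂`: every subgroup elliptic in `T₁` is elliptic in `T₂`. -/
def Dominates (T₁ T₂ : GTree G) : Prop :=
  ∀ H : Subgroup G, T₁.EllipticSubgroup H → T₂.EllipticSubgroup H

/-- `T` is an `𝒜`-tree: all its edge stabilizers belong to `𝒜`. -/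
def IsATree (T : GTree G) (𝒜 : Set (Subgroup G)) : Prop :=
  ∀ a b : T.V, T.graph.Adj a b → T.edgeStab a b ∈ 𝒜

/-- A subgroup is universally elliptic if it is elliptic in every `𝒜`-tree. -/
def UnivEllipticSubgroup (𝒜 : Set (Subgroup G)) (H : Subgroup G) : Prop :=
  ∀ T : GTree G, T.IsATree 𝒜 → T.EllipticSubgroup H

/-- An `𝒜`-tree is universally elliptic if all its edge stabilizers are universally elliptic. -/
def UnivEllipticTree (T : GTree G) (𝒜 : Set (Subgroup G)) : Prop :=
  ∀ a b : T.V, T.graph.Adj a b → UnivEllipticSubgroup 𝒜 (T.edgeStab a b)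

/-- A JSJ tree of `G` over `𝒜`: a universally elliptic `𝒜`-tree dominating every
universally elliptic `𝒜`-tree. -/
def IsJSJ (T : GTree G) (𝒜 : Set (Subgroup G)) : Prop :=
  T.IsATree 𝒜 ∧ T.UnivEllipticTree 𝒜 ∧
    ∀ T' : GTree G, T'.IsATree 𝒜 → T'.UnivEllipticTree 𝒜 → T.Dominates T'

/-- A collapse map `T → T'`: a `G`-equivariant surjection on vertices sending adjacent
vertices to adjacent or equal vertices, with connected point preimages. -/
def IsCollapseMap (T T' : GTree G) (f : T.V → T'.V) : Prop :=
  (∀ g w, f (T.act g w) = T'.act g (f w)) ∧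
    Function.Surjective f ∧
    (∀ a b : T.V, T.graph.Adj a b → f a = f b ∨ T'.graph.Adj (f a) (f b)) ∧
    ∀ w : T'.V, (T.graph.induce (f ⁻¹' {w})).Connected

end GTree

/-- `𝒜` is closed under conjugation and under passing to subgroups. -/
def ClosedFamily {G : Type u} [Group G] (𝒜 : Set (Subgroup G)) : Prop :=
  (∀ H ∈ 𝒜, ∀ g : G, Subgroup.map (MulAut.conj g).toMonoidHom H ∈ 𝒜) ∧
    ∀ H ∈ 𝒜, ∀ K : Subgroup G, K ≤ H → K ∈ 𝒜

/-- `G` is finitely presented: it admits a presentation with finitely many generators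
and finitely many relations. -/
def FinitelyPresentedGroup (G : Type u) [Group G] : Prop :=
  ∃ (n : ℕ) (rels : Set (FreeGroup (Fin n))),
    rels.Finite ∧ Nonempty (PresentedGroup rels ≃* G)

/-- `T` is an `(𝒜,ℋ)`-tree: an `𝒜`-tree in which every subgroup in `ℋ` is elliptic. -/
def RelATree {G : Type u} [Group G] (𝒜 ℋ : Set (Subgroup G)) (T : GTree G) : Prop :=
  T.IsATree 𝒜 ∧ ∀ H ∈ ℋ, T.EllipticSubgroup H

/-- A subgroup is universally elliptic relative to `ℋ` if it is elliptic in every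
`(𝒜,ℋ)`-tree. -/
def RelUnivEllipticSubgroup {G : Type u} [Group G] (𝒜 ℋ : Set (Subgroup G))
    (K : Subgroup G) : Prop :=
  ∀ T : GTree G, RelATree 𝒜 ℋ T → T.EllipticSubgroup K

/-- An `(𝒜,ℋ)`-tree is universally elliptic if all its edge stabilizers are universally
elliptic relative to `ℋ`. -/
def RelUnivEllipticTree {G : Type u} [Group G] (𝒜 ℋ : Set (Subgroup G))
    (T : GTree G) : Prop :=
  ∀ a b : T.V, T.graph.Adj a b → RelUnivEllipticSubgroup 𝒜 ℋ (T.edgeStab a b)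

/-- A JSJ tree of `G` over `𝒜` relative to `ℋ`. -/
def IsRelJSJ {G : Type u} [Group G] (𝒜 ℋ : Set (Subgroup G)) (T : GTree G) : Prop :=
  RelATree 𝒜 ℋ T ∧ RelUnivEllipticTree 𝒜 ℋ T ∧
    ∀ T' : GTree G, RelATree 𝒜 ℋ T' → RelUnivEllipticTree 𝒜 ℋ T' → T.Dominates T'

/-- The family of groups `F, H₁, …, H_p` whose free product is used to define relative
finite presentability. -/
def relFam {G : Type u} [Group G] {p : ℕ} (H : Fin p → Subgroup G) (n : ℕ) :
    Option (Fin p) → Type u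
  | none => FreeGroup (ULift.{u} (Fin n))
  | some j => H j

instance relFamGroup {G : Type u} [Group G] {p : ℕ} (H : Fin p → Subgroup G) (n : ℕ) :
    (i : Option (Fin p)) → Group (relFam H n i)
  | none => inferInstanceAs (Group (FreeGroup _))
  | some j => inferInstanceAs (Group (H j))

/-- `G` is finitely presented relative to `H₁, …, H_p`: there is a surjection from
`F ∗ H₁ ∗ ⋯ ∗ H_p` (with `F` a finitely generated free group) onto `G` restricting to
the inclusion on each `Hᵢ`, whose kernel is the normal closure of a finite subset. -/
def RelFinitelyPresented {G : Type u} [Group G] {p : ℕ} (H : Fin p → Subgroup G) : Prop :=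
  ∃ (n : ℕ) (φ : Monoid.CoprodI (relFam H n) →* G),
    Function.Surjective φ ∧
    (∀ (j : Fin p) (h : H j), φ (Monoid.CoprodI.of (M := relFam H n) (i := some j) h) = (h : G)) ∧
    ∃ s : Set (Monoid.CoprodI (relFam H n)), s.Finite ∧
      MonoidHom.ker φ = Subgroup.normalClosure s

/-- `S` has a single orbit of edges. -/
def OneEdgeOrbit {G : Type u} [Group G] (S : GTree G) : Prop :=
  ∀ e₁ ∈ S.graph.edgeSet, ∀ e₂ ∈ S.graph.edgeSet, ∃ g : G, Sym2.map (S.act g) e₁ = e₂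

/-- `G` splits over `K`: there is a nontrivial `G`-tree with a single orbit of edges
having `K` as an edge stabilizer. -/
def SplitsOver {G : Type u} [Group G] (K : Subgroup G) : Prop :=
  ∃ S : GTree G, Nontrivial S.V ∧ OneEdgeOrbit S ∧
    ∃ x y : S.V, S.graph.Adj x y ∧ S.edgeStab x y = K

/-- A subgroup is slender if all its subgroups are finitely generated. -/
def SlenderSubgroup {G : Type u} [Group G] (H : Subgroup G) : Prop :=
  ∀ K : Subgroup G, K ≤ H → K.FG

/-- A subgroup is abelian. -/
def AbelianSubgroup {G : Type u} [Group G] (H : Subgroup G) : Prop :=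
  ∀ a ∈ H, ∀ b ∈ H, a * b = b * a

/-- `H` is malnormal in `G`: `gHg⁻¹ ∩ H ≠ {1}` implies `g ∈ H`. -/
def Malnormal {G : Type u} [Group G] (H : Subgroup G) : Prop :=
  ∀ g : G, (∃ x ∈ H, x ≠ 1 ∧ g * x * g⁻¹ ∈ H) → g ∈ H

/-- `G` is CSA: the centralizer of every nontrivial element is abelian and malnormal. -/
def IsCSA (G : Type u) [Group G] : Prop :=
  ∀ g : G, g ≠ 1 →
    AbelianSubgroup (Subgroup.centralizer {g}) ∧ Malnormal (Subgroup.centralizer {g})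

namespace SimpleGraph.IsTree

variable {V : Type*} {Γ : SimpleGraph V}

theorem length_eq_dist (h : Γ.IsTree) {a b : V} {p : Γ.Walk a b} (hp : p.IsPath) :
    p.length = Γ.dist a b := by
  obtain ⟨q, hq, hl⟩ := h.connected.exists_path_of_dist a b
  have := (h.isAcyclic.subsingleton_path a b).elim ⟨p, hp⟩ ⟨q, hq⟩
  rw [← hl, Subtype.mk.inj this]

theorem tri (h : Γ.IsTree) (a b c : V) : Γ.dist a c ≤ Γ.dist a b + Γ.dist b c :=
  h.connected.dist_triangle

theorem eq_of_dist (h : Γ.IsTree) {a b : V} (hd : Γ.dist a b = 0) : a = b :=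
  h.connected.dist_eq_zero_iff.1 hd

theorem between_of_mem (h : Γ.IsTree) {a b v : V} {p : Γ.Walk a b}
    (hp : p.length = Γ.dist a b) (hv : v ∈ p.support) :
    Γ.dist a v + Γ.dist v b = Γ.dist a b := by
  classical
  have h1 := congrArg Walk.length (p.take_spec hv)
  rw [Walk.length_append] at h1
  have h2 := dist_le (p.takeUntil v hv)
  have h3 := dist_le (p.dropUntil v hv)
  have h4 := h.tri a v b
  omega

theorem exists_geodesic_through (h : Γ.IsTree) {a b m : V}
    (hm : Γ.dist a m + Γ.dist m b = Γ.dist a b) :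
    ∃ (p : Γ.Walk a m) (q : Γ.Walk m b), p.length = Γ.dist a m ∧ q.length = Γ.dist m b ∧
      (p.append q).IsPath := by
  obtain ⟨p, hp⟩ := h.connected.exists_walk_length_eq_dist a m
  obtain ⟨q, hq⟩ := h.connected.exists_walk_length_eq_dist m b
  refine ⟨p, q, hp, hq, ?_⟩
  apply Walk.isPath_of_length_eq_dist
  rw [Walk.length_append]
  omega

/-- Two points of a geodesic segment are ordered along it. -/
theorem between_split (h : Γ.IsTree) {a b m n : V}
    (hm : Γ.dist a m + Γ.dist m b = Γ.dist a b) (hn : Γ.dist a n + Γ.dist n b = Γ.dist a b) :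
    Γ.dist a n + Γ.dist n m = Γ.dist a m ∨ Γ.dist m n + Γ.dist n b = Γ.dist m b := by
  obtain ⟨p, q, hp, hq, hpq⟩ := h.exists_geodesic_through hm
  obtain ⟨p', q', hp', hq', hpq'⟩ := h.exists_geodesic_through hn
  have he : p.append q = p'.append q' :=
    congrArg Subtype.val ((h.isAcyclic.subsingleton_path a b).elim ⟨_, hpq⟩ ⟨_, hpq'⟩)
  have hmem : n ∈ (p.append q).support := by
    rw [he]; simp
  rw [Walk.mem_support_append_iff] at hmem
  rcases hmem with hmem | hmem
  · exact Or.inl (h.between_of_mem hp hmem)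
  · exact Or.inr (h.between_of_mem hq hmem)

theorem dist_of_between (h : Γ.IsTree) {a b m n : V}
    (hm : Γ.dist a m + Γ.dist m b = Γ.dist a b) (hn : Γ.dist a n + Γ.dist n b = Γ.dist a b)
    (hle : Γ.dist a m ≤ Γ.dist a n) : Γ.dist a m + Γ.dist m n = Γ.dist a n := by
  have := Γ.dist_comm (u := m) (v := n)
  rcases h.between_split hm hn with h1 | h1 <;> omega

/-- Any three vertices of a tree have a median. -/
theorem exists_median (h : Γ.IsTree) (a b c : V) :
    ∃ m, Γ.dist a m + Γ.dist m b = Γ.dist a b ∧ Γ.dist a m + Γ.dist m c = Γ.dist a c ∧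
      Γ.dist b m + Γ.dist m c = Γ.dist b c := by
  classical
  have hex : ∃ k m, Γ.dist a m + Γ.dist m b = Γ.dist a b ∧ Γ.dist c m = k :=
    ⟨_, a, by simp, rfl⟩
  obtain ⟨m, hm, hk⟩ := Nat.find_spec hex
  have hmin : ∀ n, Γ.dist a n + Γ.dist n b = Γ.dist a b → Γ.dist c m ≤ Γ.dist c n := by
    intro n hn
    rw [hk]
    exact Nat.find_min' hex ⟨n, hn, rfl⟩
  have key : ∀ e, (∀ v, Γ.dist m v + Γ.dist v e = Γ.dist m e →
      Γ.dist a v + Γ.dist v b = Γ.dist a b) → Γ.dist c m + Γ.dist m e = Γ.dist c e := by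
    intro e he
    obtain ⟨p, hp, hpl⟩ := h.connected.exists_path_of_dist c m
    obtain ⟨q, hq, hql⟩ := h.connected.exists_path_of_dist m e
    have : (p.append q).IsPath := by
      rw [Walk.isPath_def, Walk.support_append, List.nodup_append]
      refine ⟨hp.support_nodup, hq.support_nodup.tail, ?_⟩
      rintro v hv w hw rfl
      have hvq : v ∈ q.support := List.mem_of_mem_tail hw
      have h1 := h.between_of_mem hpl hv
      have h2 := hmin v (he v (h.between_of_mem hql hvq))
      have h3 : v = m := h.eq_of_dist (by omega)
      subst h3
      have := hq.support_nodup
      rw [← Walk.cons_tail_support] at this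
      exact (List.nodup_cons.1 this).1 hw
    rw [← h.length_eq_dist this, Walk.length_append, hpl, hql]
  have c1 := fun x y => Γ.dist_comm (u := x) (v := y)
  have ka := key a (by
    intro v hv
    have := h.tri v m b
    have := h.tri a v b
    have := c1 m v; have := c1 v a; have := c1 m a
    omega)
  have kb := key b (by
    intro v hv
    have := h.tri a m v
    have := h.tri a v b
    have := c1 m v; have := c1 v a; have := c1 m a
    omega)
  refine ⟨m, hm, ?_, ?_⟩
  · have := c1 c m; have := c1 c a; have := c1 m a
    omega
  · have := c1 c m; have := c1 c b; have := c1 m b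
    omega

/-- The four-point inequality in trees. -/
theorem fourPoint (h : Γ.IsTree) (a b c e : V) :
    Γ.dist a b + Γ.dist c e ≤ Γ.dist a c + Γ.dist b e ∨
      Γ.dist a b + Γ.dist c e ≤ Γ.dist a e + Γ.dist b c := by
  obtain ⟨m, h1, h2, h3⟩ := h.exists_median a b c
  obtain ⟨n, h4, h5, h6⟩ := h.exists_median a b e
  have c1 := Γ.dist_comm (u := m) (v := n)
  have c2 := Γ.dist_comm (u := b) (v := n)
  have c3 := Γ.dist_comm (u := b) (v := m)
  have c4 := Γ.dist_comm (u := c) (v := m)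
  have t1 := h.tri c m e
  have t2 := h.tri m n e
  rcases le_total (Γ.dist a m) (Γ.dist a n) with hle | hle
  · have := h.dist_of_between h1 h4 hle
    omega
  · have := h.dist_of_between h4 h1 hle
    omega

theorem even_dist (h : Γ.IsTree) (a b c : V) :
    Even (Γ.dist a b + Γ.dist b c + Γ.dist a c) := by
  obtain ⟨m, h1, h2, h3⟩ := h.exists_median a b c
  have c3 := Γ.dist_comm (u := b) (v := m)
  exact ⟨Γ.dist a m + Γ.dist b m + Γ.dist m c, by omega⟩

/-- Geodesics issued from `o` agree up to the Gromov product of their endpoints. -/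
theorem eq_of_gromov (h : Γ.IsTree) {o p q u v : V}
    (hu : Γ.dist o u + Γ.dist u p = Γ.dist o p) (hv : Γ.dist o v + Γ.dist v q = Γ.dist o q)
    (huv : Γ.dist o u = Γ.dist o v)
    (hg : 2 * Γ.dist o u + Γ.dist p q ≤ Γ.dist o p + Γ.dist o q) : u = v := by
  apply h.eq_of_dist
  have c := fun x y => Γ.dist_comm (u := x) (v := y)
  have f1 := h.fourPoint u q o p
  have f2 := h.fourPoint u v o q
  have := c u o; have := c v o; have := c q o; have := c q p; have := c p o; have := c v q
  have := c u q
  have := h.tri o u q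
  omega

theorem exists_between (h : Γ.IsTree) {a b : V} {k : ℕ} (hk : k ≤ Γ.dist a b) :
    ∃ m, Γ.dist a m = k ∧ k + Γ.dist m b = Γ.dist a b := by
  obtain ⟨p, hp⟩ := h.connected.exists_walk_length_eq_dist a b
  have h1 := dist_le (p.take k)
  have h2 := dist_le (p.drop k)
  have h3 := h.between_of_mem hp (p.getVert_mem_support k)
  rw [Walk.take_length] at h1
  rw [Walk.drop_length] at h2
  exact ⟨p.getVert k, by omega, by omega⟩

theorem adj_of_between (h : Γ.IsTree) {a b u v : V}
    (hu : Γ.dist a u + Γ.dist u b = Γ.dist a b) (hv : Γ.dist a v + Γ.dist v b = Γ.dist a b)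
    (huv : Γ.dist a v = Γ.dist a u + 1) : Γ.Adj u v := by
  have := h.dist_of_between hu hv (by omega)
  exact dist_eq_one_iff_adj.1 (by omega)

/-- An edge separates the vertices of a tree in two sides, and the only edge joining both sides
is the given one. -/
theorem eq_of_side (h : Γ.IsTree) {a c u v : V} (hac : Γ.Adj a c) (huv : Γ.Adj u v)
    (hu : Γ.dist u a < Γ.dist u c) (hv : ¬ Γ.dist v a < Γ.dist v c) : u = a ∧ v = c := by
  have h1 := dist_eq_one_iff_adj.2 hac
  have h2 := dist_eq_one_iff_adj.2 huv
  have h3 := h.dist_ne_of_adj v hac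
  have f1 := h.fourPoint u c a v
  have := Γ.dist_comm (u := c) (v := a)
  have := Γ.dist_comm (u := c) (v := v)
  have := Γ.dist_comm (u := a) (v := v)
  exact ⟨h.eq_of_dist (by omega), h.eq_of_dist (by omega)⟩

end SimpleGraph.IsTree

namespace SimpleGraph

variable {V : Type*} {Γ : SimpleGraph V}

/-- A set of vertices containing all geodesics between its points. -/
def GeodConvex (Γ : SimpleGraph V) (Y : Set V) : Prop :=
  ∀ a ∈ Y, ∀ b ∈ Y, ∀ m, Γ.dist a m + Γ.dist m b = Γ.dist a b → m ∈ Y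

theorem GeodConvex.inter {Y Z : Set V} (hY : Γ.GeodConvex Y) (hZ : Γ.GeodConvex Z) :
    Γ.GeodConvex (Y ∩ Z) :=
  fun a ha b hb m hm => ⟨hY a ha.1 b hb.1 m hm, hZ a ha.2 b hb.2 m hm⟩

theorem Reachable.exists_adj_crossing {a b : V} (h : Γ.Reachable a b) (P : V → Prop) (ha : P a)
    (hb : ¬ P b) : ∃ u v, Γ.Adj u v ∧ P u ∧ ¬ P v := by
  obtain ⟨p⟩ := h
  obtain ⟨d, -, h1, h2⟩ := p.exists_boundary_dart {v | P v} ha hb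
  exact ⟨_, _, d.adj, h1, h2⟩

namespace IsTree

theorem exists_first_edge (h : Γ.IsTree) {a b : V} (hab : a ≠ b) :
    ∃ c, Γ.Adj a c ∧ Γ.dist a b = Γ.dist c b + 1 := by
  have h1 := h.connected.pos_dist_of_ne hab
  obtain ⟨c, hc, hc'⟩ := h.exists_between (k := 1) h1
  exact ⟨c, dist_eq_one_iff_adj.1 hc, by omega⟩

theorem geodConvex_of_crossing (h : Γ.IsTree) {Y : Set V}
    (hY : ∀ P : V → Prop, ∀ a ∈ Y, ∀ b ∈ Y, P a → ¬ P b →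
      ∃ u ∈ Y, ∃ v ∈ Y, Γ.Adj u v ∧ P u ∧ ¬ P v) : Γ.GeodConvex Y := by
  suffices ∀ k, ∀ a ∈ Y, ∀ b ∈ Y, ∀ m, Γ.dist a m + Γ.dist m b = Γ.dist a b →
      Γ.dist a m = k → m ∈ Y from fun a ha b hb m hm => this _ a ha b hb m hm rfl
  intro k
  induction k with
  | zero =>
    intro a ha b _ m _ hk
    rwa [← h.eq_of_dist hk]
  | succ k ih =>
    intro a ha b hb m hm hk
    have hne : a ≠ m := by
      rintro rfl
      simp at hk
    obtain ⟨c, hc, hc'⟩ := h.exists_first_edge hne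
    have t1 := h.tri c m b
    have t2 := h.tri a c b
    have h1 := dist_eq_one_iff_adj.2 hc
    have s := Γ.dist_comm (u := c) (v := b)
    have s' := Γ.dist_comm (u := a) (v := b)
    obtain ⟨u, hu, v, hv, huv, hu1, hv1⟩ := hY (fun x => Γ.dist x a < Γ.dist x c) a ha b hb
      (by simp [h1]) (by omega)
    obtain ⟨rfl, rfl⟩ := h.eq_of_side hc huv hu1 hv1
    exact ih v hv b hb m (by omega) (by omega)

theorem geodConvex_of_connected (h : Γ.IsTree) {Y : Set V} (hY : (Γ.induce Y).Connected) :
    Γ.GeodConvex Y := by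
  apply h.geodConvex_of_crossing
  intro P a ha b hb h1 h2
  obtain ⟨u, v, huv, hu, hv⟩ :=
    (hY.preconnected ⟨a, ha⟩ ⟨b, hb⟩).exists_adj_crossing (fun x => P x.1) h1 h2
  exact ⟨u, u.2, v, v.2, huv, hu, hv⟩

theorem connected_of_geodConvex (h : Γ.IsTree) {Y : Set V} (hY : Γ.GeodConvex Y)
    (hne : Y.Nonempty) : (Γ.induce Y).Connected := by
  have : Nonempty Y := hne.to_subtype
  refine ⟨?_⟩
  rintro ⟨a, ha⟩ ⟨b, hb⟩
  obtain ⟨k, hk⟩ : ∃ k, Γ.dist a b = k := ⟨_, rfl⟩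
  induction k generalizing a with
  | zero =>
    obtain rfl := h.eq_of_dist hk
    exact Reachable.refl _
  | succ k ih =>
    have hne : a ≠ b := by
      rintro rfl
      simp at hk
    obtain ⟨c, hc, hc'⟩ := h.exists_first_edge hne
    have h1 := dist_eq_one_iff_adj.2 hc
    have hcY : c ∈ Y := hY a ha b hb c (by omega)
    refine Reachable.trans (Adj.reachable ?_) (ih c hcY (by omega))
    exact hc

theorem helly_three (h : Γ.IsTree) {A B C : Set V} (hA : Γ.GeodConvex A) (hB : Γ.GeodConvex B)
    (hC : Γ.GeodConvex C) (hAB : (A ∩ B).Nonempty) (hBC : (B ∩ C).Nonempty)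
    (hAC : (A ∩ C).Nonempty) : (A ∩ B ∩ C).Nonempty := by
  obtain ⟨x, hx⟩ := hAB
  obtain ⟨y, hy⟩ := hBC
  obtain ⟨z, hz⟩ := hAC
  obtain ⟨m, h1, h2, h3⟩ := h.exists_median x y z
  exact ⟨m, ⟨hA x hx.1 z hz.1 m h2, hB x hx.2 y hy.1 m h1⟩, hC y hy.2 z hz.2 m h3⟩

theorem helly (h : Γ.IsTree) {ι : Type*} (s : Finset ι) (Y : ι → Set V)
    (hY : ∀ i ∈ s, Γ.GeodConvex (Y i)) (hpair : ∀ i ∈ s, ∀ j ∈ s, (Y i ∩ Y j).Nonempty) :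
    ∃ v, ∀ i ∈ s, v ∈ Y i := by
  classical
  induction s using Finset.induction_on generalizing Y with
  | empty => exact ⟨h.connected.nonempty.some, by simp⟩
  | insert i s _ ih =>
    obtain ⟨v, hv⟩ := ih (fun j => Y j ∩ Y i)
      (fun j hj => (hY j (by simp [hj])).inter (hY i (by simp)))
      (fun j hj k hk => by
        obtain ⟨x, hx⟩ := h.helly_three (hY j (by simp [hj])) (hY k (by simp [hk]))
          (hY i (by simp)) (hpair _ (by simp [hj]) _ (by simp [hk]))
          (hpair _ (by simp [hk]) _ (by simp)) (hpair _ (by simp [hj]) _ (by simp))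
        exact ⟨x, ⟨hx.1.1, hx.2⟩, hx.1.2, hx.2⟩)
    rcases s.eq_empty_or_nonempty with rfl | ⟨j, hj⟩
    · obtain ⟨x, hx⟩ := hpair i (by simp) i (by simp)
      exact ⟨x, by simpa using hx⟩
    · refine ⟨v, fun k hk => ?_⟩
      rcases Finset.mem_insert.1 hk with rfl | hk
      · exact (hv j hj).2
      · exact (hv k hk).1

/-- Paths from `z` to a convex set pass through a nearest point. -/
theorem dist_of_nearest (h : Γ.IsTree) {Y : Set V} (hY : Γ.GeodConvex Y) {y z y' : V}
    (hy : y ∈ Y) (hy' : y' ∈ Y) (hmin : ∀ a ∈ Y, Γ.dist y z ≤ Γ.dist a z) :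
    Γ.dist y' z = Γ.dist y z + Γ.dist y y' := by
  obtain ⟨m, h1, h2, h3⟩ := h.exists_median y y' z
  have hm := hmin m (hY y hy y' hy' m h1)
  obtain rfl : y = m := h.eq_of_dist (by omega)
  have := Γ.dist_comm (u := y) (v := y')
  omega

/-- The shortest segment joining two disjoint convex sets is unique. -/
theorem bridge_unique (h : Γ.IsTree) {Y Z : Set V} (hY : Γ.GeodConvex Y) (hZ : Γ.GeodConvex Z)
    {y z y' z' : V} (hy : y ∈ Y) (hz : z ∈ Z) (hy' : y' ∈ Y) (hz' : z' ∈ Z)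
    (hmin : ∀ a ∈ Y, ∀ b ∈ Z, Γ.dist y z ≤ Γ.dist a b) (heq : Γ.dist y' z' = Γ.dist y z)
    (hpos : 0 < Γ.dist y z) : y' = y := by
  have c := fun x y => Γ.dist_comm (u := x) (v := y)
  have h1 := h.dist_of_nearest hY hy hy' (z := z) fun a ha => hmin a ha z hz
  have h2 := h.dist_of_nearest hZ hz hz' (z := y) fun b hb => by
    rw [c z y, c b y]
    exact hmin y hy b hb
  have h3 := h.dist_of_nearest hY hy' hy (z := z') fun a ha => by
    rw [heq]
    exact hmin a ha z' hz'
  have f1 := h.fourPoint y z' y' z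
  apply h.eq_of_dist
  rw [c z' z, c z' y'] at f1
  rw [c z' y, c z y] at h2
  rw [c y' y] at h3
  rw [c y' y]
  omega

end IsTree

end SimpleGraph

/-- An action without inversions on a tree. -/
structure IsTreeAction (G : Type*) [Group G] {V : Type*} [MulAction G V] (Γ : SimpleGraph V) :
    Prop where
  isTree : Γ.IsTree
  adj : ∀ (g : G) (a b : V), Γ.Adj a b → Γ.Adj (g • a) (g • b)
  noInv : ∀ (g : G) (a b : V), Γ.Adj a b → ¬ (g • a = b ∧ g • b = a)

/-- `H` fixes a point of `V`. -/
def HasFixedPoint {G : Type*} [Group G] (H : Subgroup G) (V : Type*) [MulAction G V] : Prop :=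
  ∃ w : V, ∀ h ∈ H, h • w = w

theorem HasFixedPoint.mono {G : Type*} [Group G] {H K : Subgroup G} {V : Type*} [MulAction G V]
    (h : HasFixedPoint K V) (hle : H ≤ K) : HasFixedPoint H V :=
  let ⟨w, hw⟩ := h
  ⟨w, fun g hg => hw g (hle hg)⟩

namespace IsTreeAction

variable {G : Type*} [Group G] {V : Type*} [MulAction G V] {Γ : SimpleGraph V}

theorem dist_smul (hS : IsTreeAction G Γ) (g : G) (a b : V) :
    Γ.dist (g • a) (g • b) = Γ.dist a b := by
  have key : ∀ (g : G) (a b : V), Γ.dist (g • a) (g • b) ≤ Γ.dist a b := by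
    intro g a b
    obtain ⟨p, hp⟩ := hS.isTree.connected.exists_walk_length_eq_dist a b
    let f : Γ →g Γ := ⟨fun x => g • x, fun {x y} hxy => hS.adj g x y hxy⟩
    have := SimpleGraph.dist_le (p.map f)
    rw [SimpleGraph.Walk.length_map, hp] at this
    exact this
  apply le_antisymm (key g a b)
  simpa using key g⁻¹ (g • a) (g • b)

theorem fixed_convex (hS : IsTreeAction G Γ) (H : Subgroup G) :
    Γ.GeodConvex {w : V | ∀ h ∈ H, h • w = w} := by
  intro a ha b hb m hm g hg
  have h1 := hS.dist_smul g a m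
  have h2 := hS.dist_smul g m b
  rw [ha g hg] at h1
  rw [hb g hg] at h2
  exact hS.isTree.eq_of_gromov (o := a) (p := b) (q := b) (by omega) hm h1
    (by simp only [SimpleGraph.dist_self]; omega)

theorem fixed_between (hS : IsTreeAction G Γ) {g : G} {a b m : V} (ha : g • a = a)
    (hb : g • b = b) (hm : Γ.dist a m + Γ.dist m b = Γ.dist a b) : g • m = m := by
  have h1 := hS.dist_smul g a m
  have h2 := hS.dist_smul g m b
  rw [ha] at h1
  rw [hb] at h2
  exact hS.isTree.eq_of_gromov (o := a) (p := b) (q := b) (by omega) hm h1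
    (by simp only [SimpleGraph.dist_self]; omega)

/-- A subgroup preserving two convex sets with at most one common point is elliptic. -/
theorem hasFixedPoint_of_invariant_pair (hS : IsTreeAction G Γ) {H : Subgroup G} {Y Z : Set V}
    (hY : Γ.GeodConvex Y) (hZ : Γ.GeodConvex Z) (hYn : Y.Nonempty) (hZn : Z.Nonempty)
    (hYi : ∀ h ∈ H, ∀ y ∈ Y, h • y ∈ Y) (hZi : ∀ h ∈ H, ∀ y ∈ Z, h • y ∈ Z)
    (hsub : ∀ a ∈ Y ∩ Z, ∀ b ∈ Y ∩ Z, a = b) :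
    ∃ w ∈ Y, ∀ h ∈ H, h • w = w := by
  classical
  have hex : ∃ k, ∃ y ∈ Y, ∃ z ∈ Z, Γ.dist y z = k := by
    obtain ⟨y, hy⟩ := hYn
    obtain ⟨z, hz⟩ := hZn
    exact ⟨_, y, hy, z, hz, rfl⟩
  obtain ⟨y, hy, z, hz, hk⟩ := Nat.find_spec hex
  have hmin : ∀ a ∈ Y, ∀ b ∈ Z, Γ.dist y z ≤ Γ.dist a b := by
    intro a ha b hb
    rw [hk]
    exact Nat.find_min' hex ⟨a, ha, b, hb, rfl⟩
  refine ⟨y, hy, fun h hh => ?_⟩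
  rcases Nat.eq_zero_or_pos (Γ.dist y z) with h0 | h0
  · obtain rfl := hS.isTree.eq_of_dist h0
    exact hsub _ ⟨hYi h hh y hy, hZi h hh y hz⟩ _ ⟨hy, hz⟩
  · exact hS.isTree.bridge_unique hY hZ hy hz (hYi h hh y hy) (hZi h hh z hz) hmin
      (hS.dist_smul h y z) h0

theorem hasFixedPoint_in_invariant (hS : IsTreeAction G Γ) {H : Subgroup G} {Y : Set V}
    (hY : Γ.GeodConvex Y) (hYn : Y.Nonempty) (hYi : ∀ h ∈ H, ∀ y ∈ Y, h • y ∈ Y)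
    (hH : HasFixedPoint H V) : ∃ w ∈ Y, ∀ h ∈ H, h • w = w := by
  obtain ⟨v, hv⟩ := hH
  refine hS.hasFixedPoint_of_invariant_pair hY (Z := {v}) ?_ hYn ⟨v, rfl⟩ hYi ?_ ?_
  · rintro a rfl b rfl m hm
    simp only [SimpleGraph.dist_self] at hm
    exact (hS.isTree.eq_of_dist (by omega)).symm
  · rintro h hh y rfl
    exact hv h hh
  · rintro a ⟨-, rfl⟩ b ⟨-, rfl⟩
    rfl

/-- An elliptic element fixes the midpoint of `[z, b z]`. -/
theorem fixes_midpoint (hS : IsTreeAction G Γ) {b : G} {w : V} (hw : b • w = w) {z m : V}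
    (h1 : Γ.dist z m + Γ.dist m (b • z) = Γ.dist z (b • z))
    (h2 : Γ.dist z m = Γ.dist m (b • z)) : b • m = m := by
  obtain ⟨k, k1, k2, k3⟩ := hS.isTree.exists_median w z (b • z)
  have e1 := hS.dist_smul b w z
  have e2 := hS.dist_smul b w k
  have e3 := hS.dist_smul b k z
  rw [hw] at e1 e2
  have c := fun x y => Γ.dist_comm (u := x) (v := y)
  have := c k z
  have hkm : k = m := hS.isTree.eq_of_gromov (o := z) (p := b • z) (q := b • z) k3 h1 (by omega)
    (by simp only [SimpleGraph.dist_self]; omega)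
  subst hkm
  exact hS.isTree.eq_of_gromov (o := w) (p := b • z) (q := b • z) (by omega) k2 e2
    (by simp only [SimpleGraph.dist_self]; omega)

theorem exists_midpoint (hS : IsTreeAction G Γ) {b : G} {w : V} (hw : b • w = w) (z : V) :
    ∃ m, Γ.dist z m + Γ.dist m (b • z) = Γ.dist z (b • z) ∧ Γ.dist z m = Γ.dist m (b • z) := by
  obtain ⟨k, k1, k2, k3⟩ := hS.isTree.exists_median w z (b • z)
  have e1 := hS.dist_smul b w z
  rw [hw] at e1
  have := Γ.dist_comm (u := k) (v := z)
  exact ⟨k, k3, by omega⟩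

/-- Serre's lemma for two elliptic elements with elliptic product. -/
theorem exists_common_fixed (hS : IsTreeAction G Γ) {a b : G} {x y z : V} (ha : a • x = x)
    (hb : b • y = y) (hab : (a * b) • z = z) : ∃ m : V, a • m = m ∧ b • m = m := by
  obtain ⟨m, h1, h2⟩ := hS.exists_midpoint hb z
  refine ⟨m, ?_, hS.fixes_midpoint hb h1 h2⟩
  have e : a • b • z = z := by rw [← mul_smul, hab]
  have c := fun x y => Γ.dist_comm (u := x) (v := y)
  have := c m z; have := c m (b • z); have := c z (b • z)
  apply hS.fixes_midpoint ha (z := b • z)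
  · rw [e]; omega
  · rw [e]; omega

/-- Serre's lemma: a finitely generated group of elliptic elements is elliptic. -/
theorem hasFixedPoint_of_fg (hS : IsTreeAction G Γ) {H : Subgroup G} (hH : H.FG)
    (hell : ∀ h ∈ H, ∃ w : V, h • w = w) : HasFixedPoint H V := by
  obtain ⟨s, rfl⟩ := hH
  have hsub : ∀ g ∈ s, g ∈ Subgroup.closure (s : Set G) := fun g hg => Subgroup.subset_closure hg
  obtain ⟨v, hv⟩ := hS.isTree.helly s (fun g => {w : V | g • w = w})
    (fun g _ a ha b hb m hm => hS.fixed_between ha hb hm)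
    (fun a ha b hb => by
      obtain ⟨x, hx⟩ := hell a (hsub a ha)
      obtain ⟨y, hy⟩ := hell b (hsub b hb)
      obtain ⟨z, hz⟩ := hell (a * b) (mul_mem (hsub a ha) (hsub b hb))
      exact hS.exists_common_fixed hx hy hz)
  refine ⟨v, fun h hh => ?_⟩
  have : Subgroup.closure (s : Set G) ≤ MulAction.stabilizer G v :=
    (Subgroup.closure_le _).2 fun g hg => hv g hg
  exact this hh

theorem eq_smul_of_backtrack (hS : IsTreeAction G Γ) {g : G} {x u v : V}
    (hu : Γ.dist x u + Γ.dist u (g • x) = Γ.dist x (g • x))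
    (hv : Γ.dist x v + Γ.dist v (g • x) = Γ.dist x (g • x))
    (huv : Γ.dist u (g • x) = Γ.dist x v)
    (hb : 2 * Γ.dist x v + Γ.dist x (g • g • x) ≤ 2 * Γ.dist x (g • x)) : u = g • v := by
  have e1 := hS.dist_smul g x (g • x)
  have e2 := hS.dist_smul g x v
  have e3 := hS.dist_smul g v (g • x)
  have c1 := Γ.dist_comm (u := u) (v := g • x)
  have c2 := Γ.dist_comm (u := x) (v := g • x)
  have c3 := Γ.dist_comm (u := x) (v := u)
  apply hS.isTree.eq_of_gromov (o := g • x) (p := x) (q := g • g • x)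
  · omega
  · omega
  · omega
  · omega

/-- If `g` fixes no vertex, then `d(x, g² x) > d(x, g x)`. -/
theorem dist_lt_dist_sq (hS : IsTreeAction G Γ) {g : G} (hg : ∀ w : V, g • w ≠ w) (x : V) :
    Γ.dist x (g • x) < Γ.dist x (g • g • x) := by
  by_contra hlt
  have hT := hS.isTree
  rcases Nat.even_or_odd' (Γ.dist x (g • x)) with ⟨k, hk | hk⟩
  · obtain ⟨m, hm1, hm2⟩ := hT.exists_between (a := x) (b := g • x) (k := k) (by omega)
    exact hg m (hS.eq_smul_of_backtrack (g := g) (x := x) (u := m) (v := m) (by omega) (by omega)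
      (by omega) (by omega)).symm
  · obtain ⟨m, hm1, hm2⟩ := hT.exists_between (a := x) (b := g • x) (k := k) (by omega)
    obtain ⟨n, hn1, hn2⟩ := hT.exists_between (a := x) (b := g • x) (k := k + 1) (by omega)
    have hadj : Γ.Adj m n := hT.adj_of_between (a := x) (b := g • x) (by omega) (by omega)
      (by omega)
    obtain ⟨r, hr⟩ := hT.even_dist x (g • x) (g • g • x)
    have e1 := hS.dist_smul g x (g • x)
    refine hS.noInv g m n hadj ⟨?_, ?_⟩
    · exact (hS.eq_smul_of_backtrack (g := g) (x := x) (u := n) (v := m) (by omega) (by omega)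
        (by omega) (by omega)).symm
    · exact (hS.eq_smul_of_backtrack (g := g) (x := x) (u := m) (v := n) (by omega) (by omega)
        (by omega) (by omega)).symm

/-- A hyperbolic element has an axis. -/
theorem exists_axis (hS : IsTreeAction G Γ) {g : G} (hg : ∀ w : V, g • w ≠ w) :
    ∃ (x : V) (l : ℕ), 0 < l ∧ ∀ n : ℕ, Γ.dist x (g ^ n • x) = n * l := by
  classical
  have hT := hS.isTree
  have hex : ∃ k, ∃ x : V, Γ.dist x (g • x) = k := ⟨_, hT.connected.nonempty.some, rfl⟩
  obtain ⟨x, hx⟩ := Nat.find_spec hex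
  have hmin : ∀ y : V, Γ.dist x (g • x) ≤ Γ.dist y (g • y) := by
    intro y
    rw [hx]
    exact Nat.find_min' hex ⟨y, rfl⟩
  have c := fun x y => Γ.dist_comm (u := x) (v := y)
  have hpos : 0 < Γ.dist x (g • x) := hT.connected.pos_dist_of_ne fun h => hg x h.symm
  have h2 : Γ.dist x (g • g • x) = 2 * Γ.dist x (g • x) := by
    by_contra hne
    have hlt := hS.dist_lt_dist_sq hg x
    obtain ⟨r, hr⟩ := hT.even_dist x (g • x) (g • g • x)
    have e1 := hS.dist_smul g x (g • x)
    have ht := hT.tri x (g • x) (g • g • x)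
    obtain ⟨m, hm1, hm2⟩ := hT.exists_between (a := x) (b := g • x) (k := 1) hpos
    obtain ⟨n, hn1, hn2⟩ := hT.exists_between (a := x) (b := g • x)
      (k := Γ.dist x (g • x) - 1) (by omega)
    have hgm : n = g • m := hS.eq_smul_of_backtrack (g := g) (x := x) (by omega) (by omega)
      (by omega) (by omega)
    have h3 := hmin m
    rw [← hgm] at h3
    have := hT.dist_of_between (a := x) (b := g • x) (m := m) (n := n) (by omega) (by omega)
      (by omega)
    omega
  refine ⟨x, Γ.dist x (g • x), hpos, ?_⟩
  have key : ∀ n : ℕ, Γ.dist x (g ^ n • x) = n * Γ.dist x (g • x) ∧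
      Γ.dist x (g ^ (n + 1) • x) = (n + 1) * Γ.dist x (g • x) := by
    intro n
    induction n with
    | zero => simp
    | succ n ih =>
      refine ⟨by simpa using ih.2, ?_⟩
      rcases n with _ | n
      · simpa [pow_two, mul_smul] using h2
      · obtain ⟨ih1, ih2⟩ := ih
        have e1 := hS.dist_smul g x (g ^ (n + 2) • x)
        have e2 := hS.dist_smul g x (g ^ (n + 1) • x)
        have e3 := hS.dist_smul (g ^ (n + 2)) x (g • x)
        rw [← mul_smul, ← pow_succ'] at e1 e2
        rw [← mul_smul, ← pow_succ] at e3
        have f1 := hT.fourPoint x (g ^ (n + 2) • x) (g • x) (g ^ (n + 2 + 1) • x)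
        have ht := hT.tri x (g ^ (n + 2) • x) (g ^ (n + 2 + 1) • x)
        have := c (g • x) (g ^ (n + 2) • x)
        ring_nf at *
        omega
  exact fun n => (key n).1

theorem hyperbolic_pow (hS : IsTreeAction G Γ) {g : G} (hg : ∀ w : V, g • w ≠ w) {k : ℕ}
    (hk : 0 < k) (w : V) : g ^ k • w ≠ w := by
  intro hw
  obtain ⟨x, l, hl, hx⟩ := hS.exists_axis hg
  have h1 : ∀ m : ℕ, (g ^ k) ^ m • w = w := by
    intro m
    have : g ^ k ∈ MulAction.stabilizer G w := hw
    exact pow_mem this m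
  have h2 := hx (k * (2 * Γ.dist x w + 1))
  have h3 := hS.dist_smul ((g ^ k) ^ (2 * Γ.dist x w + 1)) w x
  rw [h1, ← pow_mul] at h3
  have h4 := hS.isTree.tri x w (g ^ (k * (2 * Γ.dist x w + 1)) • x)
  have := Γ.dist_comm (u := w) (v := x)
  have h5 : 1 * (2 * Γ.dist x w + 1) * 1 ≤ k * (2 * Γ.dist x w + 1) * l :=
    Nat.mul_le_mul (Nat.mul_le_mul hk le_rfl) hl
  omega

end IsTreeAction

/-- The action of the free group on `ℤ × Bool` in which `true` shifts the first coordinate and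
`false` flips the second one over `0`. -/
noncomputable def freeGroupAction : FreeGroup Bool →* Equiv.Perm (ℤ × Bool) :=
  FreeGroup.lift fun i => cond i ((Equiv.addRight (1 : ℤ)).prodCongr (Equiv.refl Bool))
    (Equiv.swap ((0 : ℤ), true) ((0 : ℤ), false))

theorem freeGroupAction_shift (n : ℕ) (k : ℤ) (e : Bool) :
    freeGroupAction (FreeGroup.of true ^ n) (k, e) = (k + n, e) := by
  induction n generalizing k with
  | zero => simp
  | succ n ih =>
    rw [pow_succ, map_mul, Equiv.Perm.mul_apply]
    have : freeGroupAction (FreeGroup.of true) (k, e) = (k + 1, e) := by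
      simp [freeGroupAction]
    rw [this, ih]
    push_cast
    ring_nf

theorem freeGroupAction_flip (k : ℤ) (hk : k ≠ 0) (e : Bool) :
    freeGroupAction (FreeGroup.of false) (k, e) = (k, e) := by
  simp only [freeGroupAction, FreeGroup.lift_apply_of, cond_false]
  apply Equiv.swap_apply_of_ne_of_ne <;> simp [hk]

/-- The elements of the free group fixing `(k, e)` for `k > N`. -/
def freeGroupEventual (N : ℕ) : Subgroup (FreeGroup Bool) where
  carrier := {g | ∀ k : ℤ, (N : ℤ) < k → ∀ e, freeGroupAction g (k, e) = (k, e)}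
  one_mem' := by simp
  mul_mem' := by
    intro a b ha hb k hk e
    rw [map_mul, Equiv.Perm.mul_apply, hb k hk, ha k hk]
  inv_mem' := by
    intro a ha k hk e
    rw [map_inv, Equiv.Perm.inv_eq_iff_eq, ha k hk]

theorem freeGroupEventual_mono : Monotone freeGroupEventual := by
  intro m n hmn g hg k hk e
  exact hg k (lt_of_le_of_lt (by exact_mod_cast hmn) hk) e

theorem exists_not_fg_freeGroup : ∃ K : Subgroup (FreeGroup Bool), ¬ K.FG := by
  refine ⟨⨆ N, freeGroupEventual N, ?_⟩
  rintro ⟨S, hS⟩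
  have hmem : ∀ g, g ∈ ⨆ N, freeGroupEventual N ↔ ∃ N, g ∈ freeGroupEventual N := fun g =>
    Subgroup.mem_iSup_of_directed freeGroupEventual_mono.directed_le
  have hfin : ∀ S : Finset (FreeGroup Bool), (∀ s ∈ S, ∃ N, s ∈ freeGroupEventual N) →
      ∃ N, ∀ s ∈ S, s ∈ freeGroupEventual N := by
    classical
    intro S
    induction S using Finset.induction_on with
    | empty => exact fun _ => ⟨0, by simp⟩
    | insert a S _ ih =>
      intro h
      obtain ⟨N, hN⟩ := ih fun s hs => h s (by simp [hs])
      obtain ⟨M, hM⟩ := h a (by simp)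
      refine ⟨max M N, fun s hs => ?_⟩
      rcases Finset.mem_insert.1 hs with rfl | hs
      · exact freeGroupEventual_mono (le_max_left _ _) hM
      · exact freeGroupEventual_mono (le_max_right _ _) (hN s hs)
  obtain ⟨N, hN⟩ := hfin S fun s hs => (hmem s).1 (hS ▸ Subgroup.subset_closure hs)
  have hle : ⨆ N, freeGroupEventual N ≤ freeGroupEventual N := by
    rw [← hS]
    exact (Subgroup.closure_le _).2 hN
  set b : FreeGroup Bool := FreeGroup.of true ^ (N + 1) with hb
  have hinv : ∀ (k : ℤ) (e : Bool), freeGroupAction b⁻¹ (k, e) = (k - (N + 1), e) := by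
    intro k e
    rw [map_inv, Equiv.Perm.inv_eq_iff_eq, hb, freeGroupAction_shift]
    push_cast
    ring_nf
  have hx : b * FreeGroup.of false * b⁻¹ ∈ ⨆ N, freeGroupEventual N := by
    refine (hmem _).2 ⟨N + 1, fun k hk e => ?_⟩
    push_cast at hk
    rw [map_mul, map_mul, Equiv.Perm.mul_apply, Equiv.Perm.mul_apply, hinv,
      freeGroupAction_flip _ (by omega), hb, freeGroupAction_shift]
    push_cast
    ring_nf
  have := hle hx (N + 1) (by omega) true
  rw [map_mul, map_mul, Equiv.Perm.mul_apply, Equiv.Perm.mul_apply, hinv, hb] at this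
  have h2 : freeGroupAction (FreeGroup.of false) ((0 : ℤ), true) = ((0 : ℤ), false) := by
    simp [freeGroupAction]
  rw [sub_self, h2, freeGroupAction_shift] at this
  simp at this

theorem SlenderSubgroup.not_injective_freeGroup {G : Type*} [Group G] {J : Subgroup G}
    (hJ : SlenderSubgroup J) (φ : FreeGroup Bool →* G) (hφ : ∀ i, φ (FreeGroup.of i) ∈ J) :
    ¬ Function.Injective φ := by
  intro hinj
  obtain ⟨K, hK⟩ := exists_not_fg_freeGroup
  have hr : φ.range ≤ J := by
    rw [MonoidHom.range_eq_map, ← FreeGroup.closure_range_of, MonoidHom.map_closure,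
      Subgroup.closure_le]
    rintro _ ⟨_, ⟨i, rfl⟩, rfl⟩
    exact hφ i
  have h1 := hJ (K.map φ) ((Subgroup.map_le_range φ K).trans hr)
  rw [Subgroup.fg_iff_submonoid_fg] at h1 hK
  exact hK (Submonoid.FG.map_injective φ hinj h1)

namespace IsTreeAction

variable {G : Type*} [Group G] {V : Type*} [MulAction G V] {Γ : SimpleGraph V}

theorem injective_of_ping_pong (hS : IsTreeAction G Γ) {a : Bool → G} (x : V)
    (ha : ∀ i, ∀ w : V, a i • w ≠ w)
    (hd : ∀ s t : G, (s = a true ∨ s = (a true)⁻¹) → (t = a false ∨ t = (a false)⁻¹) →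
      Γ.dist x (s • x) < Γ.dist (s • x) (t • x) ∧ Γ.dist x (t • x) < Γ.dist (s • x) (t • x)) :
    Function.Injective (FreeGroup.lift a) := by
  have hT := hS.isTree
  have key : ∀ s t : G, Γ.dist x (s • x) < Γ.dist (s • x) (t • x) →
      Γ.dist x (t • x) < Γ.dist (s • x) (t • x) →
      ∀ v : V, Γ.dist (s • x) v ≤ Γ.dist x v → Γ.dist (t • x) v ≤ Γ.dist x v → False := by
    intro s t h1 h2 v h3 h4
    have f1 := hT.fourPoint (s • x) (t • x) x v
    have := Γ.dist_comm (u := x) (v := s • x)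
    have := Γ.dist_comm (u := x) (v := t • x)
    omega
  have hd' : ∀ i j : Bool, i ≠ j → ∀ s t : G, (s = a i ∨ s = (a i)⁻¹) →
      (t = a j ∨ t = (a j)⁻¹) →
      Γ.dist x (s • x) < Γ.dist (s • x) (t • x) ∧ Γ.dist x (t • x) < Γ.dist (s • x) (t • x) := by
    intro i j hij s t hs ht
    cases i <;> cases j
    · exact absurd rfl hij
    · rw [Γ.dist_comm (u := s • x)]
      exact (hd t s ht hs).symm
    · exact hd s t hs ht
    · exact absurd rfl hij
  suffices hinj : Function.Injective (FreeGroup.lift fun i : ULift Bool => a i.down) by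
    have he : FreeGroup.lift a = (FreeGroup.lift fun i : ULift Bool => a i.down).comp
        (FreeGroup.freeGroupCongr Equiv.ulift.symm).toMonoidHom := by
      ext i
      simp
    rw [he, MonoidHom.coe_comp]
    exact hinj.comp (MulEquiv.injective _)
  refine FreeGroup.injective_lift_of_ping_pong (fun i : ULift Bool => a i.down)
    (fun i : ULift Bool => {v : V | Γ.dist (a i.down • x) v < Γ.dist x v})
    (fun i : ULift Bool => {v : V | Γ.dist ((a i.down)⁻¹ • x) v ≤ Γ.dist x v}) ?_ ?_ ?_ ?_ ?_ ?_
  · intro i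
    refine ⟨a i.down • x, ?_⟩
    simpa using hT.connected.pos_dist_of_ne (ha i.down x).symm
  · intro i j hij
    refine Set.disjoint_left.2 fun v h1 h2 => ?_
    obtain ⟨h3, h4⟩ := hd' i.down j.down (fun e => hij (ULift.ext _ _ e)) _ _
      (Or.inl rfl) (Or.inl rfl)
    exact key _ _ h3 h4 v (le_of_lt h1) (le_of_lt h2)
  · intro i j hij
    refine Set.disjoint_left.2 fun v h1 h2 => ?_
    obtain ⟨h3, h4⟩ := hd' i.down j.down (fun e => hij (ULift.ext _ _ e)) _ _
      (Or.inr rfl) (Or.inr rfl)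
    exact key _ _ h3 h4 v h1 h2
  · intro i j
    refine Set.disjoint_left.2 fun v h1 h2 => ?_
    by_cases hij : i = j
    · subst hij
      have h5 := hS.dist_lt_dist_sq (ha i.down) x
      have e1 := hS.dist_smul (a i.down) ((a i.down)⁻¹ • x) (a i.down • x)
      have e2 := hS.dist_smul (a i.down) ((a i.down)⁻¹ • x) x
      rw [smul_inv_smul] at e1 e2
      have c1 := Γ.dist_comm (u := x) (v := (a i.down)⁻¹ • x)
      have c2 := Γ.dist_comm (u := a i.down • x) (v := (a i.down)⁻¹ • x)
      exact key (a i.down) (a i.down)⁻¹ (by omega) (by omega) v (le_of_lt h1) h2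
    · obtain ⟨h3, h4⟩ := hd' i.down j.down (fun e => hij (ULift.ext _ _ e)) _ _
        (Or.inl rfl) (Or.inr rfl)
      exact key _ _ h3 h4 v (le_of_lt h1) h2
  · rintro i _ ⟨v, hv, rfl⟩
    simp only [Set.mem_compl_iff, Set.mem_ofPred_eq, not_le] at hv ⊢
    have e1 := hS.dist_smul (a i.down) ((a i.down)⁻¹ • x) v
    have e2 := hS.dist_smul (a i.down) x v
    rw [smul_inv_smul] at e1
    show Γ.dist (a i.down • x) (a i.down • v) < Γ.dist x (a i.down • v)
    omega
  · rintro i _ ⟨v, hv, rfl⟩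
    simp only [Set.mem_compl_iff, Set.mem_ofPred_eq, not_lt] at hv ⊢
    have e1 := hS.dist_smul (a i.down)⁻¹ (a i.down • x) v
    have e2 := hS.dist_smul (a i.down)⁻¹ x v
    rw [inv_smul_smul] at e1
    show Γ.dist ((a i.down)⁻¹ • x) ((a i.down)⁻¹ • v) ≤ Γ.dist x ((a i.down)⁻¹ • v)
    omega

/-- Translation along an axis. -/
theorem smul_eq_of_axis (hS : IsTreeAction G Γ) {p : G} {x z w : V} {l N : ℕ}
    (hp : ∀ n : ℕ, Γ.dist x (p ^ n • x) = n * l)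
    (hz : Γ.dist x z + Γ.dist z (p ^ N • x) = Γ.dist x (p ^ N • x))
    (hw : Γ.dist x w + Γ.dist w (p ^ N • x) = Γ.dist x (p ^ N • x))
    (hzw : Γ.dist x w = Γ.dist x z + l) : p • z = w := by
  have hT := hS.isTree
  have e1 := hS.dist_smul p x z
  have e2 := hS.dist_smul p z (p ^ N • x)
  have e3 := hS.dist_smul p x (p ^ N • x)
  have e4 := hS.dist_smul (p ^ N) x (p • x)
  rw [← mul_smul, ← pow_succ'] at e2 e3
  rw [← mul_smul, ← pow_succ] at e4
  have h1 := hp 1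
  have h2 := hp N
  have h3 := hp (N + 1)
  rw [pow_one] at h1
  rw [one_mul] at h1
  rw [add_mul, one_mul] at h3
  have t1 := hT.tri x (p • x) (p • z)
  have t2 := hT.tri x (p • z) (p ^ (N + 1) • x)
  have t3 := hT.tri w (p ^ N • x) (p ^ (N + 1) • x)
  have t4 := hT.tri x w (p ^ (N + 1) • x)
  refine hT.eq_of_gromov (o := x) (p := p ^ (N + 1) • x) (q := p ^ (N + 1) • x) ?_ ?_ ?_ ?_
  · omega
  · omega
  · omega
  · rw [SimpleGraph.dist_self]
    omega

/-- Two elements whose axes have a long overlap commute. -/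
theorem commute_of_overlap (hS : IsTreeAction G Γ)
    (hab : ∀ a b, Γ.Adj a b → AbelianSubgroup (MulAction.stabilizer G a ⊓ MulAction.stabilizer G b))
    (hcsa : IsCSA G) {p q : G} {x y : V} {l N : ℕ}
    (hp : ∀ n : ℕ, Γ.dist x (p ^ n • x) = n * l) (hq : ∀ n : ℕ, Γ.dist y (q ^ n • y) = n * l)
    (hov : 2 * (Γ.dist x y + 2 * l + 1) + Γ.dist (p ^ N • x) (q ^ N • y) ≤
      Γ.dist x (p ^ N • x) + Γ.dist x (q ^ N • y)) : p * q = q * p := by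
  have hT := hS.isTree
  have t0 := hT.tri x (p ^ N • x) (q ^ N • y)
  have key : ∀ t, Γ.dist x y ≤ t → t ≤ Γ.dist x y + 2 * l + 1 → ∃ z,
      (Γ.dist x z = t ∧ Γ.dist x z + Γ.dist z (p ^ N • x) = Γ.dist x (p ^ N • x)) ∧
      Γ.dist y z + Γ.dist z (q ^ N • y) = Γ.dist y (q ^ N • y) ∧
      t + Γ.dist z (q ^ N • y) = Γ.dist x (q ^ N • y) := by
    intro t h1 h2
    obtain ⟨z, hz1, hz2⟩ := hT.exists_between (a := x) (b := p ^ N • x) (k := t) (by omega)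
    have f1 := hT.fourPoint z (q ^ N • y) x (p ^ N • x)
    have f2 := hT.fourPoint x (q ^ N • y) y z
    have := hT.tri x z (q ^ N • y)
    have := hT.tri y z (q ^ N • y)
    have := hT.tri z y (q ^ N • y)
    have := Γ.dist_comm (u := y) (v := z)
    have c1 := Γ.dist_comm (u := q ^ N • y) (v := z)
    have c2 := Γ.dist_comm (u := q ^ N • y) (v := y)
    have c3 := Γ.dist_comm (u := x) (v := z)
    have c4 := Γ.dist_comm (u := x) (v := q ^ N • y)
    have c5 := Γ.dist_comm (u := p ^ N • x) (v := q ^ N • y)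
    have h3 : t + Γ.dist z (q ^ N • y) = Γ.dist x (q ^ N • y) := by omega
    exact ⟨z, ⟨hz1, by omega⟩, by omega, h3⟩
  have move : ∀ t z w, Γ.dist x z = t ∧ Γ.dist x z + Γ.dist z (p ^ N • x) = Γ.dist x (p ^ N • x) →
      Γ.dist y z + Γ.dist z (q ^ N • y) = Γ.dist y (q ^ N • y) ∧
      t + Γ.dist z (q ^ N • y) = Γ.dist x (q ^ N • y) →
      Γ.dist x w = t + l ∧ Γ.dist x w + Γ.dist w (p ^ N • x) = Γ.dist x (p ^ N • x) →
      Γ.dist y w + Γ.dist w (q ^ N • y) = Γ.dist y (q ^ N • y) ∧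
      t + l + Γ.dist w (q ^ N • y) = Γ.dist x (q ^ N • y) → p • z = w ∧ q • z = w := by
    intro t z w h1 h2 h3 h4
    exact ⟨hS.smul_eq_of_axis hp h1.2 h3.2 (by omega),
      hS.smul_eq_of_axis hq h2.1 h4.1 (by omega)⟩
  obtain ⟨a0, p0, q0⟩ := key (Γ.dist x y) (by omega) (by omega)
  obtain ⟨b0, p1, q1⟩ := key (Γ.dist x y + 1) (by omega) (by omega)
  obtain ⟨a1, p2, q2⟩ := key (Γ.dist x y + l) (by omega) (by omega)
  obtain ⟨b1, p3, q3⟩ := key (Γ.dist x y + 1 + l) (by omega) (by omega)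
  obtain ⟨a2, p4, q4⟩ := key (Γ.dist x y + l + l) (by omega) (by omega)
  obtain ⟨b2, p5, q5⟩ := key (Γ.dist x y + 1 + l + l) (by omega) (by omega)
  obtain ⟨m1, m2⟩ := move _ _ _ p0 q0 p2 q2
  obtain ⟨m3, m4⟩ := move _ _ _ p1 q1 p3 q3
  obtain ⟨m5, m6⟩ := move _ _ _ p2 q2 p4 q4
  obtain ⟨m7, m8⟩ := move _ _ _ p3 q3 p5 q5
  have hadj : Γ.Adj a1 b1 := hT.adj_of_between p2.2 p3.2 (by omega)
  have hc : ∀ u v : V, p • u = v → q • u = v → (p⁻¹ * q) • u = u := by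
    intro u v h1 h2
    rw [mul_smul, h2, ← h1, inv_smul_smul]
  have hc' : ∀ u v : V, p • u = v → q • u = v → (q * p⁻¹) • v = v := by
    intro u v h1 h2
    rw [mul_smul, ← h1, inv_smul_smul, h2, h1]
  have hcomm := hab a1 b1 hadj (p⁻¹ * q) ⟨hc _ _ m5 m6, hc _ _ m7 m8⟩ (q * p⁻¹)
    ⟨hc' _ _ m1 m2, hc' _ _ m3 m4⟩
  by_cases h1 : p⁻¹ * q = 1
  · rw [inv_mul_eq_one.1 h1]
  · have hmal := (hcsa _ h1).2 p ⟨p⁻¹ * q, Subgroup.mem_centralizer_singleton_iff.2 rfl, h1, by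
      rw [Subgroup.mem_centralizer_singleton_iff]
      have : p * (p⁻¹ * q) * p⁻¹ = q * p⁻¹ := by group
      rw [this, hcomm]⟩
    rw [Subgroup.mem_centralizer_singleton_iff] at hmal
    have : p * (p * (p⁻¹ * q)) = p * ((p⁻¹ * q) * p) := by rw [hmal]
    simpa [mul_assoc] using this

/-- In a CSA group, non-abelian slender subgroups are elliptic in trees with abelian edge
stabilizers. -/
theorem hasFixedPoint_of_slender (hS : IsTreeAction G Γ)
    (hab : ∀ a b, Γ.Adj a b → AbelianSubgroup (MulAction.stabilizer G a ⊓ MulAction.stabilizer G b))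
    (hcsa : IsCSA G) {J : Subgroup G} (hJ : SlenderSubgroup J) (hJn : ¬ AbelianSubgroup J) :
    HasFixedPoint J V := by
  by_contra hno
  obtain ⟨h, hhJ, hh⟩ : ∃ h ∈ J, ∀ w : V, h • w ≠ w := by
    by_contra hcon
    push Not at hcon
    exact hno (hS.hasFixedPoint_of_fg (hJ J le_rfl) hcon)
  have hT := hS.isTree
  obtain ⟨x, l, hl, hx⟩ := hS.exists_axis hh
  have hh1 : h ≠ 1 := by
    rintro rfl
    exact hh x (one_smul _ _)
  obtain ⟨u, huJ, hu⟩ : ∃ u ∈ J, u ∉ Subgroup.centralizer {h} := by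
    by_contra hcon
    push Not at hcon
    exact hJn fun a ha b hb => (hcsa h hh1).1 a (hcon a ha) b (hcon b hb)
  have huh : ¬ (h * (u * h * u⁻¹) = u * h * u⁻¹ * h) := fun heq =>
    hu ((hcsa h hh1).2 u ⟨h, Subgroup.mem_centralizer_singleton_iff.2 rfl, hh1,
      Subgroup.mem_centralizer_singleton_iff.2 heq.symm⟩)
  have hx' : ∀ n : ℕ, Γ.dist x (h⁻¹ ^ n • x) = n * l := by
    intro n
    have := hS.dist_smul (h ^ n) x (h⁻¹ ^ n • x)
    rw [← mul_smul, inv_pow, mul_inv_cancel, one_smul] at this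
    rw [inv_pow, ← this, Γ.dist_comm, hx]
  have hconj : ∀ k : G, (∀ n : ℕ, Γ.dist x (k ^ n • x) = n * l) →
      ∀ n : ℕ, Γ.dist (u • x) ((u * k * u⁻¹) ^ n • u • x) = n * l := by
    intro k hk n
    rw [conj_pow, mul_smul, inv_smul_smul, mul_smul, hS.dist_smul, hk]
  set N := 8 * (Γ.dist x (u • x) + 2 * l + 1) with hN
  have hNl : 8 * (Γ.dist x (u • x) + 2 * l + 1) ≤ N * l := Nat.le_mul_of_pos_right _ hl
  have main : ∀ p k : G, (p = h ∨ p = h⁻¹) → (k = h ∨ k = h⁻¹) →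
      Γ.dist x (p ^ N • x) < Γ.dist (p ^ N • x) ((u * k * u⁻¹) ^ N • x) ∧
      Γ.dist x ((u * k * u⁻¹) ^ N • x) < Γ.dist (p ^ N • x) ((u * k * u⁻¹) ^ N • x) := by
    intro p k hp hk
    have hpx : ∀ n : ℕ, Γ.dist x (p ^ n • x) = n * l := by
      rcases hp with rfl | rfl <;> assumption
    have hkx : ∀ n : ℕ, Γ.dist x (k ^ n • x) = n * l := by
      rcases hk with rfl | rfl <;> assumption
    have hnc : ¬ (p * (u * k * u⁻¹) = u * k * u⁻¹ * p) := by
      intro hc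
      apply huh
      have hc : Commute p (u * k * u⁻¹) := hc
      have hc1 : Commute h (u * k * u⁻¹) := by
        rcases hp with rfl | rfl
        · exact hc
        · simpa using hc.inv_left
      rcases hk with rfl | rfl
      · exact hc1
      · have : u * h⁻¹ * u⁻¹ = (u * h * u⁻¹)⁻¹ := by group
        rw [this] at hc1
        exact Commute.inv_right_iff.1 hc1
    have hov := mt (hS.commute_of_overlap hab hcsa (N := N) hpx (hconj k hkx)) hnc
    have h1 := hpx N
    have h2 := hconj k hkx N
    have e1 := hS.dist_smul ((u * k * u⁻¹) ^ N) x (u • x)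
    generalize (u * k * u⁻¹) ^ N = Q at *
    generalize p ^ N • x = P at *
    have t1 := hT.tri x (u • x) (Q • u • x)
    have t2 := hT.tri (u • x) x (Q • u • x)
    have t3 := hT.tri P (Q • x) (Q • u • x)
    have t4 := hT.tri x (Q • u • x) (Q • x)
    have c1 := Γ.dist_comm (u := u • x) (v := x)
    have c2 := Γ.dist_comm (u := Q • u • x) (v := Q • x)
    constructor <;> omega
  have hN0 : 0 < N := by omega
  let a : Bool → G := fun i => cond i (h ^ N) ((u * h * u⁻¹) ^ N)
  refine hJ.not_injective_freeGroup (FreeGroup.lift a) ?_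
    (hS.injective_of_ping_pong (a := a) x ?_ ?_)
  · intro i
    rw [FreeGroup.lift_apply_of]
    cases i
    · exact pow_mem (mul_mem (mul_mem huJ hhJ) (inv_mem huJ)) N
    · exact pow_mem hhJ N
  · intro i w
    cases i
    · refine hS.hyperbolic_pow (fun w hw => hh (u⁻¹ • w) ?_) hN0 w
      rw [mul_smul, mul_smul] at hw
      rw [eq_inv_smul_iff, hw]
    · exact hS.hyperbolic_pow hh hN0 w
  · intro s t hs ht
    have hs' : ∃ p, (p = h ∨ p = h⁻¹) ∧ s = p ^ N := by
      rcases hs with rfl | rfl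
      · exact ⟨h, Or.inl rfl, rfl⟩
      · exact ⟨h⁻¹, Or.inr rfl, (inv_pow _ _).symm⟩
    have ht' : ∃ k, (k = h ∨ k = h⁻¹) ∧ t = (u * k * u⁻¹) ^ N := by
      rcases ht with rfl | rfl
      · exact ⟨h, Or.inl rfl, rfl⟩
      · refine ⟨h⁻¹, Or.inr rfl, ?_⟩
        have : u * h⁻¹ * u⁻¹ = (u * h * u⁻¹)⁻¹ := by group
        rw [this, inv_pow]
        rfl
    obtain ⟨p, hp, rfl⟩ := hs'
    obtain ⟨k, hk, rfl⟩ := ht'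
    exact main p k hp hk

end IsTreeAction

theorem SimpleGraph.IsTree.interval_convex {V : Type*} {Γ : SimpleGraph V} (h : Γ.IsTree)
    (a b : V) : Γ.GeodConvex {m | Γ.dist a m + Γ.dist m b = Γ.dist a b} := by
  have key : ∀ u v m, Γ.dist a u + Γ.dist u b = Γ.dist a b →
      Γ.dist a v + Γ.dist v b = Γ.dist a b → Γ.dist u m + Γ.dist m v = Γ.dist u v →
      Γ.dist a u ≤ Γ.dist a v → Γ.dist a m + Γ.dist m b = Γ.dist a b := by
    intro u v m hu hv hm hle
    have h1 := h.dist_of_between hu hv hle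
    have h2 := h.tri a u m
    have h3 := h.tri m v b
    have h4 := h.tri a m b
    omega
  intro u hu v hv m hm
  rcases le_total (Γ.dist a u) (Γ.dist a v) with hle | hle
  · exact key u v m hu hv hm hle
  · refine key v u m hv hu ?_ hle
    rw [Γ.dist_comm (u := v) (v := m), Γ.dist_comm (u := m) (v := u),
      Γ.dist_comm (u := v) (v := u)]
    omega

theorem SimpleGraph.IsTree.interval_finite {V : Type*} {Γ : SimpleGraph V} (h : Γ.IsTree)
    (a b : V) : {m | Γ.dist a m + Γ.dist m b = Γ.dist a b}.Finite := by
  apply Set.Finite.of_injOn (f := fun m => Γ.dist a m) (t := Set.Iic (Γ.dist a b)) _ _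
    (Set.finite_Iic _)
  · intro m hm
    have : Γ.dist a m + Γ.dist m b = Γ.dist a b := hm
    simp only [Set.mem_Iic]
    omega
  · intro m hm n hn hmn
    have hmn : Γ.dist a m = Γ.dist a n := hmn
    have := h.dist_of_between hm hn hmn.le
    exact h.eq_of_dist (by omega)

namespace IsTreeAction

variable {G : Type*} [Group G] {V : Type*} [MulAction G V] {Γ : SimpleGraph V}

/-- A finitely generated group acting on a tree preserves a subtree on which the action is
cofinite. -/
theorem exists_cofinite_subtree (hS : IsTreeAction G Γ) [hG : Group.FG G] (x : V) :
    ∃ F Y : Set V, F.Finite ∧ Y.Nonempty ∧ Γ.GeodConvex Y ∧ (∀ g : G, ∀ y ∈ Y, g • y ∈ Y) ∧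
      (∀ y ∈ Y, ∃ g : G, g • y ∈ F) ∧
      ∀ a ∈ Y, ∀ b ∈ Y, Γ.Adj a b → ∃ g : G, g • a ∈ F ∧ g • b ∈ F := by
  classical
  have hT := hS.isTree
  obtain ⟨S, hSgen⟩ := Group.fg_iff.1 hG
  obtain ⟨hSgen, hSfin⟩ := hSgen
  let I : G → Set V := fun s => {m | Γ.dist x m + Γ.dist m (s • x) = Γ.dist x (s • x)}
  have hI0 : ∀ s, x ∈ I s := fun s => by simp [I]
  have hI1 : ∀ s, s • x ∈ I s := fun s => by simp [I]
  let F : Set V := ⋃ s ∈ insert 1 S, I s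
  have hF : ∀ v, v ∈ F ↔ ∃ s ∈ insert 1 S, v ∈ I s := fun v => by simp [F]
  let Γ0 : SimpleGraph V :=
    { Adj := fun a b => Γ.Adj a b ∧ ∃ g : G, g • a ∈ F ∧ g • b ∈ F
      symm := ⟨fun a b h => ⟨h.1.symm, h.2.imp fun _ h => h.symm⟩⟩
      loopless := ⟨fun a h => Γ.loopless.irrefl a h.1⟩ }
  have hact : ∀ (g : G) {a b}, Γ0.Reachable a b → Γ0.Reachable (g • a) (g • b) := by
    intro g a b h
    refine h.map (G' := Γ0) ⟨fun v => g • v, ?_⟩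
    rintro a b ⟨h1, k, h2⟩
    exact ⟨hS.adj g a b h1, k * g⁻¹, by simpa [mul_smul] using h2⟩
  have hseg : ∀ s ∈ insert 1 S, ∀ v ∈ I s, Γ0.Reachable x v := by
    intro s hs v hv
    have hc := hT.connected_of_geodConvex (Y := I s) (hT.interval_convex x (s • x)) ⟨x, hI0 s⟩
    refine (hc.preconnected ⟨x, hI0 s⟩ ⟨v, hv⟩).map (G' := Γ0) ⟨fun v => v.1, ?_⟩
    rintro ⟨a, ha⟩ ⟨b, hb⟩ hab
    exact ⟨hab, 1, by rw [one_smul]; exact (hF a).2 ⟨s, hs, ha⟩,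
      by rw [one_smul]; exact (hF b).2 ⟨s, hs, hb⟩⟩
  have hgen : ∀ g : G, Γ0.Reachable x (g • x) := by
    intro g
    have hg : g ∈ Subgroup.closure S := by rw [hSgen]; trivial
    induction hg using Subgroup.closure_induction with
    | mem s hs => exact hseg s (Or.inr hs) _ (hI1 s)
    | one => rw [one_smul]
    | mul a b _ _ h1 h2 =>
      rw [mul_smul]
      exact h1.trans (hact a h2)
    | inv a _ h =>
      have := hact a⁻¹ h
      rw [inv_smul_smul] at this
      exact this.symm
  let Y : Set V := {v | ∃ g : G, g • v ∈ F}
  have hreach : ∀ v ∈ Y, Γ0.Reachable x v := by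
    rintro v ⟨g, hg⟩
    obtain ⟨s, hs, hv⟩ := (hF _).1 hg
    have := hact g⁻¹ (hseg s hs _ hv)
    rw [inv_smul_smul] at this
    exact (hgen g⁻¹).trans this
  refine ⟨F, Y, ?_, ⟨x, 1, ?_⟩, ?_, ?_, fun y hy => hy, ?_⟩
  · exact (hSfin.insert 1).biUnion fun s _ => hT.interval_finite x (s • x)
  · rw [one_smul]
    exact (hF x).2 ⟨1, Set.mem_insert _ _, hI0 1⟩
  · apply hT.geodConvex_of_crossing
    intro P a ha b hb h1 h2
    obtain ⟨u, v, huv, hu, hv⟩ :=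
      ((hreach a ha).symm.trans (hreach b hb)).exists_adj_crossing P h1 h2
    exact ⟨u, huv.2.imp fun _ h => h.1, v, huv.2.imp fun _ h => h.2, huv.1, hu, hv⟩
  · rintro g y ⟨k, hk⟩
    exact ⟨k * g⁻¹, by simpa [mul_smul] using hk⟩
  · intro a ha b hb hab
    have h1 := SimpleGraph.dist_eq_one_iff_adj.2 hab
    obtain ⟨u, v, huv, hu, hv⟩ := ((hreach a ha).symm.trans (hreach b hb)).exists_adj_crossing
      (fun w => Γ.dist w a < Γ.dist w b) (by simp [h1]) (by simp)
    obtain ⟨rfl, rfl⟩ := hT.eq_of_side hab huv.1 hu hv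
    exact huv.2

end IsTreeAction

namespace GTree

variable {G : Type u} [Group G]

instance (T : GTree G) : MulAction G T.V where
  smul := T.act
  one_smul := T.act_one
  mul_smul := T.act_mul

theorem isTreeAction (T : GTree G) : IsTreeAction G T.graph where
  isTree := ⟨T.connected, T.acyclic⟩
  adj := T.act_adj
  noInv := T.noInversion

theorem edgeStab_eq (T : GTree G) (a b : T.V) :
    T.edgeStab a b = MulAction.stabilizer G a ⊓ MulAction.stabilizer G b :=
  rfl

theorem eq_univ_of_convex (T : GTree G) {Y : Set T.V} (hY : T.graph.GeodConvex Y)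
    (hne : Y.Nonempty) (hinv : ∀ g : G, ∀ y ∈ Y, g • y ∈ Y) : Y = Set.univ :=
  T.minimal Y hne hinv (T.isTreeAction.isTree.connected_of_geodConvex hY hne)

/-- Edges of a tree with a minimal action of a finitely generated group fall in finitely many
orbits. -/
theorem exists_finite_edges (T : GTree G) [Group.FG G] :
    ∃ F : Set T.V, F.Finite ∧ ∀ a b, T.graph.Adj a b → ∃ g : G, g • a ∈ F ∧ g • b ∈ F := by
  obtain ⟨F, Y, hF, hY, hYc, hYi, -, hFe⟩ :=
    T.isTreeAction.exists_cofinite_subtree T.nonempty.some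
  have := T.eq_univ_of_convex hYc hY hYi
  exact ⟨F, hF, fun a b hab => hFe a (by rw [this]; trivial) b (by rw [this]; trivial) hab⟩

end GTree

/-- A tree with an action of a finitely generated group contains a minimal invariant subtree. -/
theorem IsTreeAction.exists_minimal_subtree {G : Type u} [Group G] [Group.FG G] {V : Type u}
    [MulAction G V] {Γ : SimpleGraph V} (hS : IsTreeAction G Γ) :
    ∃ (T : GTree G) (f : T.V → V), Function.Injective f ∧ (∀ (g : G) v, f (g • v) = g • f v) ∧
      (∀ a b, T.graph.Adj a b ↔ Γ.Adj (f a) (f b)) ∧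
      ∀ H : Subgroup G, T.EllipticSubgroup H ↔ HasFixedPoint H V := by
  classical
  obtain ⟨F, Y0, hF, hY0n, hY0c, hY0i, hYF, -⟩ :=
    hS.exists_cofinite_subtree hS.isTree.connected.nonempty.some
  have hex : ∃ k, ∃ Y : Set V, Y ⊆ Y0 ∧ Y.Nonempty ∧ Γ.GeodConvex Y ∧
      (∀ g : G, ∀ y ∈ Y, g • y ∈ Y) ∧ (Y ∩ F).ncard = k :=
    ⟨_, Y0, le_rfl, hY0n, hY0c, hY0i, rfl⟩
  obtain ⟨Y, hY0, hYn, hYc, hYi, hk⟩ := Nat.find_spec hex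
  have hmin : ∀ Z : Set V, Z ⊆ Y → Z.Nonempty → Γ.GeodConvex Z →
      (∀ g : G, ∀ y ∈ Z, g • y ∈ Z) → Y ⊆ Z := by
    intro Z hZ hZn hZc hZi y hy
    have h1 := Nat.find_min' hex ⟨Z, hZ.trans hY0, hZn, hZc, hZi, rfl⟩
    rw [← hk] at h1
    have h2 := Set.eq_of_subset_of_ncard_le (Set.inter_subset_inter_left F hZ) h1
      (hF.subset Set.inter_subset_right)
    obtain ⟨g, hg⟩ := hYF y (hY0 hy)
    have h3 : g • y ∈ Z ∩ F := by
      rw [h2]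
      exact ⟨hYi g y hy, hg⟩
    simpa using hZi g⁻¹ _ h3.1
  have hconn := hS.isTree.connected_of_geodConvex hYc hYn
  let T : GTree G :=
    { V := Y
      graph := Γ.induce Y
      nonempty := hYn.to_subtype
      connected := hconn
      acyclic := hS.isTree.isAcyclic.induce Y
      act := fun g v => ⟨g • v.1, hYi g v.1 v.2⟩
      act_one := fun v => Subtype.ext (one_smul G v.1)
      act_mul := fun g h v => Subtype.ext (mul_smul g h v.1)
      act_adj := fun g a b h => hS.adj g a.1 b.1 h
      noInversion := fun g a b h h' =>
        hS.noInv g a.1 b.1 h ⟨congrArg Subtype.val h'.1, congrArg Subtype.val h'.2⟩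
      minimal := by
        intro S hSn hSi hSc
        have hc : Γ.GeodConvex (Subtype.val '' S) := by
          apply hS.isTree.geodConvex_of_crossing
          rintro P _ ⟨a, ha, rfl⟩ _ ⟨b, hb, rfl⟩ h1 h2
          obtain ⟨u, v, huv, hu, hv⟩ := (hSc.preconnected ⟨a, ha⟩ ⟨b, hb⟩).exists_adj_crossing
            (fun w => P w.1.1) h1 h2
          exact ⟨_, ⟨u.1, u.2, rfl⟩, _, ⟨v.1, v.2, rfl⟩, huv, hu, hv⟩
        have := hmin (Subtype.val '' S) (by rintro _ ⟨a, _, rfl⟩; exact a.2) (hSn.image _) hc (by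
          rintro g _ ⟨a, ha, rfl⟩
          exact ⟨_, hSi g a ha, rfl⟩)
        refine Set.eq_univ_of_forall fun y => ?_
        obtain ⟨a, ha, hay⟩ := this y.2
        rwa [← Subtype.ext hay] }
  refine ⟨T, Subtype.val, Subtype.val_injective, fun _ _ => rfl, fun _ _ => Iff.rfl, fun H => ?_⟩
  constructor
  · rintro ⟨w, hw⟩
    exact ⟨w.1, fun h hh => congrArg Subtype.val (hw h hh)⟩
  · intro hH
    obtain ⟨w, hw, hw'⟩ := hS.hasFixedPoint_in_invariant hYc hYn (fun h _ => hYi h) hH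
    exact ⟨⟨w, hw⟩, fun h hh => Subtype.ext (hw' h hh)⟩

/-- Data for gluing convex subsets `D v` of a tree along convex subsets `DE v w`. The last two
fields say that the index set, with `v` and `w` joined when `DE v w` is nonempty, is connected and
simply connected relative to the sets `DE v w`. -/
structure GlueData (G : Type*) [Group G] (X : Type*) [MulAction G X] {V : Type*} [MulAction G V]
    (Γ : SimpleGraph V) where
  D : X → Set V
  DE : X → X → Set V
  D_convex : ∀ v, Γ.GeodConvex (D v)
  D_nonempty : ∀ v, (D v).Nonempty
  D_smul : ∀ (g : G) v, ∀ t ∈ D v, g • t ∈ D (g • v)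
  DE_subset : ∀ v w, DE v w ⊆ D v
  DE_symm : ∀ v w, DE v w ⊆ DE w v
  DE_smul : ∀ (g : G) v w, ∀ t ∈ DE v w, g • t ∈ DE (g • v) (g • w)
  DE_convex : ∀ v w, Γ.GeodConvex (DE v w)
  conn : ∀ v w, Relation.ReflTransGen (fun v w => (DE v w).Nonempty) v w
  simplyConn : ∀ b : X → X → ZMod 2,
    (∀ t, ∃ a : X → ZMod 2, ∀ v w, t ∈ DE v w → b v w = a v + a w) →
      ∃ a : X → ZMod 2, ∀ v w, (DE v w).Nonempty → b v w = a v + a w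

namespace GlueData

variable {G : Type*} [Group G] {X : Type*} [MulAction G X] {V : Type*} [MulAction G V]
  {Γ : SimpleGraph V} (d : GlueData G X Γ)

/-- The copies of `t` in `D v` and `D w` get identified. -/
def Linked (t : V) : X → X → Prop :=
  Relation.ReflTransGen fun v w => t ∈ d.DE v w

/-- `v` and `w` can be joined while identifying both `t` and `t'`. -/
def Linked₂ (t t' : V) : X → X → Prop :=
  Relation.ReflTransGen fun v w => t ∈ d.DE v w ∧ t' ∈ d.DE v w

variable {d}

theorem Linked.symm {t : V} {v w : X} (h : d.Linked t v w) : d.Linked t w v := by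
  have : Std.Symm (fun v w => t ∈ d.DE v w) := ⟨fun v w h => d.DE_symm v w h⟩
  exact Std.Symm.symm (r := Relation.ReflTransGen fun v w => t ∈ d.DE v w) _ _ h

theorem Linked.smul {t : V} {v w : X} (h : d.Linked t v w) (g : G) :
    d.Linked (g • t) (g • v) (g • w) :=
  Relation.ReflTransGen.lift (fun v => g • v) (fun v w => d.DE_smul g v w t) _ _ h

theorem Linked₂.smul {t t' : V} {v w : X} (h : d.Linked₂ t t' v w) (g : G) :
    d.Linked₂ (g • t) (g • t') (g • v) (g • w) :=
  Relation.ReflTransGen.lift (fun v => g • v)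
    (fun v w h => ⟨d.DE_smul g v w t h.1, d.DE_smul g v w t' h.2⟩) _ _ h

theorem Linked₂.symm {t t' : V} {v w : X} (h : d.Linked₂ t t' v w) : d.Linked₂ t t' w v := by
  have : Std.Symm (fun v w => t ∈ d.DE v w ∧ t' ∈ d.DE v w) :=
    ⟨fun v w h => ⟨d.DE_symm v w h.1, d.DE_symm v w h.2⟩⟩
  exact Std.Symm.symm (r := Relation.ReflTransGen fun v w => t ∈ d.DE v w ∧ t' ∈ d.DE v w) _ _ h

theorem Linked₂.left {t t' : V} {v w : X} (h : d.Linked₂ t t' v w) : d.Linked t v w :=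
  Relation.ReflTransGen.mono (fun _ _ h => h.1) _ _ h

theorem Linked₂.right {t t' : V} {v w : X} (h : d.Linked₂ t t' v w) : d.Linked t' v w :=
  Relation.ReflTransGen.mono (fun _ _ h => h.2) _ _ h

variable (d)

/-- Copies of points of `V` indexed by `X`. -/
abbrev Pt := {p : X × V // p.2 ∈ d.D p.1}

instance setoid : Setoid d.Pt where
  r p q := p.1.2 = q.1.2 ∧ d.Linked p.1.2 p.1.1 q.1.1
  iseqv :=
    { refl := fun _ => ⟨rfl, Relation.ReflTransGen.refl⟩
      symm := fun h => ⟨h.1.symm, h.1 ▸ h.2.symm⟩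
      trans := fun h k => ⟨h.1.trans k.1, h.2.trans (h.1.symm ▸ k.2)⟩ }

/-- The vertices of the glued tree. -/
def Q := Quotient d.setoid

variable {d}

/-- The copy of `t` in `D v`. -/
def pt (v : X) (t : V) (h : t ∈ d.D v) : d.Q := Quotient.mk d.setoid ⟨(v, t), h⟩

theorem pt_eq_iff {v w : X} {t s : V} {h : t ∈ d.D v} {k : s ∈ d.D w} :
    (pt v t h : d.Q) = pt w s k ↔ t = s ∧ d.Linked t v w :=
  Quotient.eq (r := d.setoid)

theorem exists_pt (q : d.Q) : ∃ v t h, q = pt v t h := by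
  induction q using Quotient.inductionOn with
  | h p => exact ⟨p.1.1, p.1.2, p.2, rfl⟩

/-- The projection of the glued tree. -/
def proj : d.Q → V := Quotient.lift (fun p => p.1.2) fun _ _ h => h.1

@[simp] theorem proj_pt {v : X} {t : V} {h : t ∈ d.D v} : proj (pt v t h : d.Q) = t := rfl

instance : MulAction G d.Q where
  smul g := Quotient.map (fun p => ⟨(g • p.1.1, g • p.1.2), d.D_smul g _ _ p.2⟩)
    fun _ _ h => ⟨congrArg (g • ·) h.1, h.2.smul g⟩
  one_smul q := by
    obtain ⟨v, t, h, rfl⟩ := exists_pt q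
    exact pt_eq_iff.2 ⟨one_smul G t, by
      show d.Linked (_ • _) (_ • _) _
      rw [one_smul, one_smul]
      exact Relation.ReflTransGen.refl⟩
  mul_smul g k q := by
    obtain ⟨v, t, h, rfl⟩ := exists_pt q
    exact pt_eq_iff.2 ⟨mul_smul g k t, by
      show d.Linked (_ • _) (_ • _) (_ • _ • _)
      rw [mul_smul, mul_smul]
      exact Relation.ReflTransGen.refl⟩

theorem smul_pt (g : G) {v : X} {t : V} {h : t ∈ d.D v} :
    g • (pt v t h : d.Q) = pt (g • v) (g • t) (d.D_smul g v t h) := rfl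

theorem proj_smul (g : G) (q : d.Q) : proj (g • q) = g • proj q := by
  obtain ⟨v, t, h, rfl⟩ := exists_pt q
  rfl

variable (d)

/-- The glued tree. -/
def graph : SimpleGraph d.Q where
  Adj q q' := Γ.Adj (proj q) (proj q') ∧ ∃ v t t' h h', q = pt v t h ∧ q' = pt v t' h'
  symm := ⟨fun _ _ ⟨h1, v, t, t', h, h', e, e'⟩ => ⟨h1.symm, v, t', t, h', h, e', e⟩⟩
  loopless := ⟨fun _ h => Γ.loopless.irrefl _ h.1⟩

variable {d}

theorem adj_proj {q q' : d.Q} (h : d.graph.Adj q q') : Γ.Adj (proj q) (proj q') := h.1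

theorem exists_of_adj {q q' : d.Q} (h : d.graph.Adj q q') : ∃ v t t' k k',
    Γ.Adj t t' ∧ q = pt v t k ∧ q' = pt v t' k' := by
  obtain ⟨h1, v, t, t', k, k', rfl, rfl⟩ := h
  exact ⟨v, t, t', k, k', h1, rfl, rfl⟩

theorem connected (hT : Γ.IsTree) [Nonempty X] : d.graph.Connected := by
  have h1 : ∀ v t s (ht : t ∈ d.D v) (hs : s ∈ d.D v),
      d.graph.Reachable (pt v t ht) (pt v s hs) := by
    intro v t s ht hs
    have hc := hT.connected_of_geodConvex (d.D_convex v) (d.D_nonempty v)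
    refine (hc.preconnected ⟨t, ht⟩ ⟨s, hs⟩).map (G' := d.graph) ⟨fun p => pt v p.1 p.2, ?_⟩
    intro a b hab
    exact ⟨hab, v, _, _, a.2, b.2, rfl, rfl⟩
  have h2 : ∀ v w t s (ht : t ∈ d.D v) (hs : s ∈ d.D w),
      d.graph.Reachable (pt v t ht) (pt w s hs) := by
    intro v w
    induction d.conn v w with
    | refl => exact fun t s ht hs => h1 v t s ht hs
    | @tail w w' _ hww ih =>
      intro t s ht hs
      obtain ⟨r, hr⟩ := hww
      have e : (pt w r (d.DE_subset _ _ hr) : d.Q) = pt w' r (d.DE_subset _ _ (d.DE_symm _ _ hr)) :=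
        pt_eq_iff.2 ⟨rfl, Relation.ReflTransGen.single hr⟩
      have h3 := ih t r ht (d.DE_subset _ _ hr)
      rw [e] at h3
      exact h3.trans (h1 w' r s _ hs)
  obtain ⟨v⟩ := ‹Nonempty X›
  obtain ⟨t, ht⟩ := d.D_nonempty v
  have : Nonempty d.Q := ⟨pt v t ht⟩
  refine ⟨fun q q' => ?_⟩
  obtain ⟨v, t, h, rfl⟩ := exists_pt q
  obtain ⟨w, s, k, rfl⟩ := exists_pt q'
  exact h2 v w t s h k

/-- The function on the glued graph separating both sides of an edge. -/
theorem exists_side (hT : Γ.IsTree) {v₀ : X} {t₀ t₁ : V} (h₀ : t₀ ∈ d.D v₀) (h₁ : t₁ ∈ d.D v₀)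
    (hadj : Γ.Adj t₀ t₁) : ∃ f : d.Q → ZMod 2,
      (∀ w k k', f (pt w t₀ k) ≠ f (pt w t₁ k') → d.Linked₂ t₀ t₁ v₀ w) ∧
      f (pt v₀ t₀ h₀) ≠ f (pt v₀ t₁ h₁) ∧
      ∀ q q', d.graph.Adj q q' → f q ≠ f q' →
        s(q, q') = s(pt v₀ t₀ h₀, pt v₀ t₁ h₁) := by
  classical
  let σ : V → ZMod 2 := fun t => if Γ.dist t t₀ < Γ.dist t t₁ then 0 else 1
  let χ : X → ZMod 2 := fun v => if d.Linked₂ t₀ t₁ v₀ v then 1 else 0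
  have hd := SimpleGraph.dist_eq_one_iff_adj.2 hadj
  have hσ0 : σ t₀ = 0 := by simp [σ, hd]
  have hσ1 : σ t₁ = 1 := by simp [σ]
  have hσ : ∀ t t', Γ.Adj t t' → σ t ≠ σ t' → (t = t₀ ∧ t' = t₁) ∨ (t = t₁ ∧ t' = t₀) := by
    intro t t' htt hne
    by_cases h1 : Γ.dist t t₀ < Γ.dist t t₁ <;> by_cases h2 : Γ.dist t' t₀ < Γ.dist t' t₁
    · simp [σ, h1, h2] at hne
    · exact Or.inl (hT.eq_of_side hadj htt h1 h2)
    · exact Or.inr (hT.eq_of_side hadj htt.symm h2 h1).symm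
    · simp [σ, h1, h2] at hne
  have hconst : ∀ v w, χ v ≠ χ w → ∀ t ∈ d.DE v w, ∀ t' ∈ d.DE v w, σ t = σ t' := by
    intro v w hvw t ht t' ht'
    by_contra hne
    have hc := hT.connected_of_geodConvex (d.DE_convex v w) ⟨t, ht⟩
    obtain ⟨x, y, hxy, hx, hy⟩ := (hc.preconnected ⟨t, ht⟩ ⟨t', ht'⟩).exists_adj_crossing
      (fun x => σ x.1 = σ t) rfl (Ne.symm hne)
    have h01 : t₀ ∈ d.DE v w ∧ t₁ ∈ d.DE v w := by
      rcases hσ x y hxy (fun h => hy (h ▸ hx)) with ⟨h1, h2⟩ | ⟨h1, h2⟩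
      · exact ⟨h1 ▸ x.2, h2 ▸ y.2⟩
      · exact ⟨h2 ▸ y.2, h1 ▸ x.2⟩
    apply hvw
    have : d.Linked₂ t₀ t₁ v₀ v ↔ d.Linked₂ t₀ t₁ v₀ w :=
      ⟨fun h => h.tail h01, fun h => h.tail ⟨d.DE_symm _ _ h01.1, d.DE_symm _ _ h01.2⟩⟩
    simp only [χ, this]
  let b : X → X → ZMod 2 := fun v w =>
    if h : (d.DE v w).Nonempty then σ h.some * (χ v + χ w) else 0
  have two : ∀ x : ZMod 2, x + x = 0 := by decide
  have hb : ∀ v w t, t ∈ d.DE v w → b v w = σ t * (χ v + χ w) := by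
    intro v w t ht
    have hn : (d.DE v w).Nonempty := ⟨t, ht⟩
    simp only [b, hn, dif_pos]
    by_cases h : χ v = χ w
    · rw [h, two, mul_zero, mul_zero]
    · rw [hconst v w h _ hn.some_mem t ht]
  obtain ⟨a, ha⟩ := d.simplyConn b fun t => ⟨fun v => σ t * χ v, fun v w ht => by
    rw [hb v w t ht, mul_add]⟩
  have hstep : ∀ t v w, t ∈ d.DE v w → a v + χ v * σ t = a w + χ w * σ t := by
    intro t v w ht
    have h1 := ha v w ⟨t, ht⟩
    rw [hb v w t ht] at h1
    generalize σ t = A at *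
    generalize χ v = B at *
    generalize χ w = C at *
    generalize a v = D at *
    generalize a w = E at *
    revert h1
    revert A B C D E
    decide
  let f : d.Q → ZMod 2 := Quotient.lift (fun p => a p.1.1 + χ p.1.1 * σ p.1.2) (by
    rintro ⟨⟨v, t⟩, ht⟩ ⟨⟨w, s⟩, hs⟩ ⟨h1, h2⟩
    dsimp only at h1 h2 ⊢
    subst h1
    clear ht hs
    induction h2 with
    | refl => rfl
    | tail _ h3 ih => rw [ih, hstep _ _ _ h3])
  have hf : ∀ v t h, f (pt v t h) = a v + χ v * σ t := fun _ _ _ => rfl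
  have hχ : ∀ w, χ w ≠ 0 → d.Linked₂ t₀ t₁ v₀ w := by
    intro w hw
    by_contra h
    simp [χ, h] at hw
  have hfχ : ∀ w t t' k k', f (pt w t k) ≠ f (pt w t' k') → χ w ≠ 0 ∧ σ t ≠ σ t' := by
    intro w t t' k k' hne
    rw [hf, hf] at hne
    refine ⟨fun h => hne ?_, fun h => hne ?_⟩
    · rw [h, zero_mul, zero_mul]
    · rw [h]
  refine ⟨f, fun w k k' hne => hχ w (hfχ w _ _ k k' hne).1, ?_, ?_⟩
  · have : χ v₀ = 1 := if_pos Relation.ReflTransGen.refl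
    rw [hf, hf, hσ0, hσ1, this]
    simp
  · intro q q' hqq hne
    obtain ⟨v, t, t', k, k', htt, rfl, rfl⟩ := exists_of_adj hqq
    obtain ⟨h1, h2⟩ := hfχ _ _ _ _ _ hne
    have h3 := hχ v h1
    rcases hσ t t' htt h2 with ⟨rfl, rfl⟩ | ⟨rfl, rfl⟩
    · rw [(pt_eq_iff (h := k) (k := h₀)).2 ⟨rfl, h3.symm.left⟩,
        (pt_eq_iff (h := k') (k := h₁)).2 ⟨rfl, h3.symm.right⟩]
    · rw [(pt_eq_iff (h := k') (k := h₀)).2 ⟨rfl, h3.symm.left⟩,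
        (pt_eq_iff (h := k) (k := h₁)).2 ⟨rfl, h3.symm.right⟩, Sym2.eq_swap]

theorem isTreeAction (hS : IsTreeAction G Γ) [Nonempty X] : IsTreeAction G d.graph where
  isTree := by
    refine ⟨connected hS.isTree, ?_⟩
    rw [SimpleGraph.isAcyclic_iff_forall_adj_isBridge]
    intro q q' hqq
    obtain ⟨v, t, t', k, k', htt, rfl, rfl⟩ := exists_of_adj hqq
    obtain ⟨f, -, hf, hf'⟩ := exists_side hS.isTree k k' htt
    rw [SimpleGraph.isBridge_iff]
    intro hr
    obtain ⟨x, y, hxy, hx, hy⟩ := hr.exists_adj_crossing (fun z => f z = f (pt v t k)) rfl hf.symm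
    rw [SimpleGraph.deleteEdges_adj] at hxy
    refine hxy.2 ?_
    rw [hf' x y hxy.1 (fun h => hy (h ▸ hx))]
    rfl
  adj := by
    intro g q q' hqq
    obtain ⟨v, t, t', k, k', htt, rfl, rfl⟩ := exists_of_adj hqq
    exact ⟨hS.adj g t t' htt, _, _, _, _, _, rfl, rfl⟩
  noInv := by
    intro g q q' hqq h
    refine hS.noInv g _ _ (adj_proj hqq) ⟨?_, ?_⟩
    · rw [← proj_smul, h.1]
    · rw [← proj_smul, h.2]

/-- The elements fixing an edge of the glued tree. -/
theorem linked₂_of_fixes (hT : Γ.IsTree) {v : X} {t t' : V} (h : t ∈ d.D v) (h' : t' ∈ d.D v)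
    (hadj : Γ.Adj t t') {g : G} (hg : g • (pt v t h : d.Q) = pt v t h)
    (hg' : g • (pt v t' h' : d.Q) = pt v t' h') : d.Linked₂ t t' v (g • v) := by
  obtain ⟨f, hf1, hf2, -⟩ := exists_side hT h h' hadj
  rw [smul_pt] at hg hg'
  have e := (pt_eq_iff.1 hg).1
  have e' := (pt_eq_iff.1 hg').1
  have m : t ∈ d.D (g • v) := by
    have := d.D_smul g v t h
    rwa [e] at this
  have m' : t' ∈ d.D (g • v) := by
    have := d.D_smul g v t' h'
    rwa [e'] at this
  apply hf1 (g • v) m m'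
  have r : (pt (g • v) t m : d.Q) = pt v t h := by
    rw [← hg]
    exact pt_eq_iff.2 ⟨e.symm, Relation.ReflTransGen.refl⟩
  have r' : (pt (g • v) t' m' : d.Q) = pt v t' h' := by
    rw [← hg']
    exact pt_eq_iff.2 ⟨e'.symm, Relation.ReflTransGen.refl⟩
  rw [r, r']
  exact hf2

theorem fixes_of_linked {v : X} {t : V} (h : t ∈ d.D v) {g : G} (hg : g • t = t)
    (hl : d.Linked t v (g • v)) : g • (pt v t h : d.Q) = pt v t h := by
  rw [smul_pt, pt_eq_iff, hg]
  exact ⟨rfl, hl.symm⟩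

end GlueData

/-- On a tree, every symmetric mod 2 function on edges is a coboundary. -/
theorem SimpleGraph.IsTree.exists_potential {V : Type*} {Γ : SimpleGraph V} (h : Γ.IsTree)
    (b : V → V → ZMod 2) (hb : ∀ v w, Γ.Adj v w → b v w = b w v) :
    ∃ a : V → ZMod 2, ∀ v w, Γ.Adj v w → b v w = a v + a w := by
  obtain ⟨r⟩ := h.connected.nonempty
  choose p hp using fun v => h.connected.exists_walk_length_eq_dist r v
  let a : V → ZMod 2 := fun v => ((p v).darts.map fun d => b d.fst d.snd).sum
  have key : ∀ v w (hvw : Γ.Adj v w), Γ.dist r w = Γ.dist r v + 1 → a w = a v + b v w := by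
    intro v w hvw hd
    have h1 : ((p v).concat hvw).IsPath := by
      apply Walk.isPath_of_length_eq_dist
      rw [Walk.length_concat, hp, hd]
    have h2 : (p w).IsPath := Walk.isPath_of_length_eq_dist _ (hp w)
    have h3 : p w = (p v).concat hvw :=
      congrArg Subtype.val ((h.isAcyclic.subsingleton_path r w).elim ⟨_, h2⟩ ⟨_, h1⟩)
    simp [a, h3, Walk.darts_concat]
  have two : ∀ x y : ZMod 2, y = x + (x + y) := by decide
  refine ⟨a, fun v w hvw => ?_⟩
  have h1 := SimpleGraph.dist_eq_one_iff_adj.2 hvw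
  have h2 := h.dist_ne_of_adj r hvw
  have t1 := h.tri r v w
  have t2 := h.tri r w v
  have := Γ.dist_comm (u := w) (v := v)
  rcases Nat.lt_or_ge (Γ.dist r v) (Γ.dist r w) with hlt | hge
  · rw [key v w hvw (by omega)]
    exact two _ _
  · rw [key w v hvw.symm (by omega), add_right_comm, add_comm (a w + a w), hb v w hvw]
    generalize a w = A
    generalize b w v = B
    revert A B
    decide

theorem IsTreeAction.fixed_unique {G : Type*} [Group G] {V : Type*} [MulAction G V]
    {Γ : SimpleGraph V} (hS : IsTreeAction G Γ)
    (hab : ∀ a b, Γ.Adj a b → AbelianSubgroup (MulAction.stabilizer G a ⊓ MulAction.stabilizer G b))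
    {K : Subgroup G} (hK : ¬ AbelianSubgroup K) {s t : V} (hs : ∀ g ∈ K, g • s = s)
    (ht : ∀ g ∈ K, g • t = t) : s = t := by
  by_contra hne
  obtain ⟨c, hc, hd⟩ := hS.isTree.exists_first_edge hne
  have h1 := SimpleGraph.dist_eq_one_iff_adj.2 hc
  have hcK := hS.fixed_convex K s hs t ht c (by omega)
  exact hK fun a ha b hb => hab s c hc a ⟨hs a ha, hcK a ha⟩ b ⟨hs b hb, hcK b hb⟩

/-- Blowing up a tree with abelian edge stabilizers in a CSA group, so that edge stabilizers become
elliptic in a tree with slender non-abelian edge stabilizers. -/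
theorem IsTreeAction.exists_blowUp {G : Type u} [Group G] (hcsa : IsCSA G) {V W : Type u}
    [MulAction G V] [MulAction G W] {Γ : SimpleGraph V} {Δ : SimpleGraph W}
    (hS : IsTreeAction G Γ)
    (hab : ∀ a b, Γ.Adj a b → AbelianSubgroup (MulAction.stabilizer G a ⊓ MulAction.stabilizer G b))
    (hR : IsTreeAction G Δ)
    (hsl : ∀ a b, Δ.Adj a b → SlenderSubgroup (MulAction.stabilizer G a ⊓ MulAction.stabilizer G b))
    (hna : ∀ a b, Δ.Adj a b →
      ¬ AbelianSubgroup (MulAction.stabilizer G a ⊓ MulAction.stabilizer G b)) :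
    ∃ (V' : Type u) (_ : MulAction G V') (Γ' : SimpleGraph V') (f : V' → V), IsTreeAction G Γ' ∧
      (∀ (g : G) v, f (g • v) = g • f v) ∧ (∀ a b, Γ'.Adj a b → Γ.Adj (f a) (f b)) ∧
      ∀ a b, Γ'.Adj a b → HasFixedPoint (MulAction.stabilizer G a ⊓ MulAction.stabilizer G b) W := by
  have hne : ∀ v w, Δ.Adj v w →
      ∃ t : V, ∀ g ∈ MulAction.stabilizer G v ⊓ MulAction.stabilizer G w, g • t = t :=
    fun v w hvw => hS.hasFixedPoint_of_slender hab hcsa (hsl v w hvw) (hna v w hvw)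
  let d : GlueData G W Γ :=
    { D := fun _ => Set.univ
      DE := fun v w => {t | Δ.Adj v w ∧
        ∀ g ∈ MulAction.stabilizer G v ⊓ MulAction.stabilizer G w, g • t = t}
      D_convex := fun _ _ _ _ _ _ _ => trivial
      D_nonempty := fun _ => ⟨hS.isTree.connected.nonempty.some, trivial⟩
      D_smul := fun _ _ _ _ => trivial
      DE_subset := fun _ _ _ _ => trivial
      DE_symm := fun v w t ht => ⟨ht.1.symm, fun g hg => ht.2 g hg.symm⟩
      DE_smul := fun g v w t ht => ⟨hR.adj g v w ht.1, fun k hk => by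
        have hk1 : k • g • v = g • v := hk.1
        have hk2 : k • g • w = g • w := hk.2
        have h1 := ht.2 (g⁻¹ * k * g) ⟨by
          show (g⁻¹ * k * g) • v = v
          rw [mul_smul, mul_smul, hk1, inv_smul_smul], by
          show (g⁻¹ * k * g) • w = w
          rw [mul_smul, mul_smul, hk2, inv_smul_smul]⟩
        rwa [mul_smul, mul_smul, inv_smul_eq_iff] at h1⟩
      DE_convex := fun v w a ha b hb m hm => ⟨ha.1, hS.fixed_convex _ a ha.2 b hb.2 m hm⟩
      conn := fun v w => Relation.ReflTransGen.mono (fun a b hab => (hne a b hab).imp fun t ht =>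
        ⟨hab, ht⟩) _ _ ((SimpleGraph.reachable_iff_reflTransGen v w).1
          (hR.isTree.connected.preconnected v w))
      simplyConn := by
        intro b hb
        have hsymm : ∀ v w, Δ.Adj v w → b v w = b w v := by
          intro v w hvw
          obtain ⟨t, ht⟩ := hne v w hvw
          obtain ⟨a, ha⟩ := hb t
          rw [ha v w ⟨hvw, ht⟩, ha w v ⟨hvw.symm, fun g hg => ht g hg.symm⟩, add_comm]
        obtain ⟨a, ha⟩ := hR.isTree.exists_potential b hsymm
        exact ⟨a, fun v w ⟨_, hvw⟩ => ha v w hvw.1⟩ }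
  have : Nonempty W := hR.isTree.connected.nonempty
  refine ⟨d.Q, inferInstance, d.graph, GlueData.proj, GlueData.isTreeAction hS,
    GlueData.proj_smul, fun _ _ => GlueData.adj_proj, ?_⟩
  intro a b hab'
  obtain ⟨v, t, t', k, k', htt, rfl, rfl⟩ := GlueData.exists_of_adj hab'
  refine ⟨v, fun g hg => ?_⟩
  have hl := GlueData.linked₂_of_fixes hS.isTree k k' htt hg.1 hg.2
  rcases Relation.ReflTransGen.cases_head hl with h | ⟨w, ⟨h1, h2⟩, -⟩
  · exact h.symm
  · exact absurd (hS.fixed_unique hab (hna v w h1.1) h1.2 h2.2) htt.ne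

/-- A group acting cofinitely on a connected graph, with elements of a group as vertices, is
finitely generated. -/
theorem Subgroup.fg_of_cofinite {G : Type*} [Group G] {α : Type*} (E : Subgroup G) (C : Set G)
    (S : Set G) (hS : S.Finite) (τ : G → α) (hτ : (τ '' C).Finite) {g₀ : G} (hg₀ : g₀ ∈ C)
    (hC : ∀ c ∈ C, Relation.ReflTransGen (fun c c' => c' ∈ C ∧ ∃ s ∈ S, c' = c * s) g₀ c)
    (hE : ∀ c ∈ C, ∀ c' ∈ C, τ c = τ c' → c' * c⁻¹ ∈ E)
    (hE' : ∀ h ∈ E, h * g₀ ∈ C ∧ τ (h * g₀) = τ g₀) : E.FG := by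
  classical
  have : ∀ x, ∃ r, x ∈ τ '' C → r ∈ C ∧ τ r = x := by
    intro x
    by_cases h : x ∈ τ '' C
    · obtain ⟨r, hr⟩ := h
      exact ⟨r, fun _ => hr⟩
    · exact ⟨1, fun h' => absurd h' h⟩
  choose r hr using this
  have hrC : ∀ c ∈ C, r (τ c) ∈ C ∧ τ (r (τ c)) = τ c := fun c hc => hr _ ⟨c, hc, rfl⟩
  have hmem : ∀ c ∈ C, c * (r (τ c))⁻¹ ∈ E := fun c hc => hE _ (hrC c hc).1 _ hc (hrC c hc).2
  let K : Set G := insert (g₀ * (r (τ g₀))⁻¹)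
    (Set.image2 (fun x y => x * y) (Set.image2 (fun x s => r x * s) (τ '' C) S)
      ((fun x => (r x)⁻¹) '' (τ '' C)))
  have hK : K.Finite := ((hτ.image2 _ hS).image2 _ (hτ.image _)).insert _
  have hcl : ∀ c ∈ C, c * (r (τ c))⁻¹ ∈ Subgroup.closure (K ∩ E) := by
    intro c hc
    have hrel := hC c hc
    clear hc
    suffices c ∈ C ∧ c * (r (τ c))⁻¹ ∈ Subgroup.closure (K ∩ E) from this.2
    induction hrel with
    | refl => exact ⟨hg₀, Subgroup.subset_closure ⟨Set.mem_insert _ _, hmem g₀ hg₀⟩⟩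
    | @tail c c' _ h ih =>
      obtain ⟨hc, ih⟩ := ih
      obtain ⟨hc', s, hs, rfl⟩ := h
      refine ⟨hc', ?_⟩
      have e : c * s * (r (τ (c * s)))⁻¹ =
          c * (r (τ c))⁻¹ * (r (τ c) * s * (r (τ (c * s)))⁻¹) := by group
      rw [e]
      refine mul_mem ih (Subgroup.subset_closure ⟨Set.mem_insert_of_mem _
        ⟨_, ⟨τ c, ⟨c, hc, rfl⟩, s, hs, rfl⟩, _, ⟨τ (c * s), ⟨_, hc', rfl⟩, rfl⟩, rfl⟩, ?_⟩)
      have := mul_mem (inv_mem (hmem c hc)) (hmem _ hc')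
      rw [e, inv_mul_cancel_left] at this
      exact this
  have hEK : E = Subgroup.closure (K ∩ E) := by
    apply le_antisymm
    · intro h hh
      obtain ⟨h1, h2⟩ := hE' h hh
      have h3 := mul_mem (hcl _ h1) (inv_mem (hcl _ hg₀))
      rw [h2] at h3
      have e : h * g₀ * (r (τ g₀))⁻¹ * (g₀ * (r (τ g₀))⁻¹)⁻¹ = h := by group
      rwa [e] at h3
    · exact (Subgroup.closure_le E).2 Set.inter_subset_right
  rw [hEK]
  exact (Subgroup.fg_iff _).2 ⟨_, rfl, hK.inter_of_left _⟩

/-- A mod 2 function on the edges of the Cayley graph of a presented group is a coboundary if it is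
one around every relator. -/
theorem exists_potential_of_presentation {G : Type*} [Group G] {ι : Type*} [DecidableEq ι]
    {rels : Set (FreeGroup ι)} (e : PresentedGroup rels ≃* G) (s : ι → G)
    (hs : ∀ i, s i = e (PresentedGroup.of i)) (b : G → G → ZMod 2)
    (hb : ∀ g i, b (g * s i) g = b g (g * s i))
    (hloc : ∀ g : G, ∃ a : G → ZMod 2, ∀ r ∈ rels, ∀ u i, ∀ ε : Bool, (i, ε) :: u <:+ r.toWord →
      ∀ h k, h = g * (e (PresentedGroup.mk rels (FreeGroup.mk u)))⁻¹ →
      k = g * (e (PresentedGroup.mk rels (FreeGroup.mk ((i, ε) :: u))))⁻¹ → b h k = a h + a k) :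
    ∃ a : G → ZMod 2, ∀ g i, b g (g * s i) = a g + a (g * s i) := by
  have two : ∀ x : ZMod 2, x + x = 0 := by decide
  let σ : ι → Equiv.Perm (G × ZMod 2) := fun i =>
    { toFun := fun p => (p.1 * (s i)⁻¹, p.2 + b (p.1 * (s i)⁻¹) p.1)
      invFun := fun p => (p.1 * s i, p.2 + b p.1 (p.1 * s i))
      left_inv := fun p => by simp [add_assoc, two]
      right_inv := fun p => by simp [add_assoc, two] }
  let val : FreeGroup ι →* G := e.toMonoidHom.comp (PresentedGroup.mk rels)
  have hval : ∀ x, val x = e (PresentedGroup.mk rels x) := fun _ => rfl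
  have hvi : ∀ i, val (FreeGroup.of i) = s i := fun i => (hs i).symm
  have hsuf : ∀ g : G, ∀ a : G → ZMod 2, ∀ r ∈ rels,
      (∀ u i, ∀ ε : Bool, (i, ε) :: u <:+ r.toWord →
        ∀ h k, h = g * (val (FreeGroup.mk u))⁻¹ →
        k = g * (val (FreeGroup.mk ((i, ε) :: u)))⁻¹ → b h k = a h + a k) →
      ∀ u, u <:+ r.toWord → ∀ c, FreeGroup.lift σ (FreeGroup.mk u) (g, c) =
        (g * (val (FreeGroup.mk u))⁻¹, c + a g + a (g * (val (FreeGroup.mk u))⁻¹)) := by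
    intro g a r hr ha u
    induction u with
    | nil =>
      intro _ c
      have h1 : (FreeGroup.mk [] : FreeGroup ι) = 1 := rfl
      simp [h1, add_assoc, two]
    | cons l u ih =>
      obtain ⟨i, ε⟩ := l
      intro hu c
      have h0 := ha u i ε hu _ _ rfl rfl
      have h1 : FreeGroup.mk ((i, ε) :: u) = FreeGroup.mk [(i, ε)] * FreeGroup.mk u := by
        simp [FreeGroup.mul_mk]
      have h2 := ih (List.IsSuffix.trans (List.suffix_cons _ _) hu) c
      cases ε with
      | true =>
        have h3 : (FreeGroup.mk [(i, true)] : FreeGroup ι) = FreeGroup.of i := rfl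
        rw [h1, h3, map_mul val, hvi, mul_inv_rev, ← mul_assoc] at h0 ⊢
        rw [map_mul, Equiv.Perm.mul_apply, h2, FreeGroup.lift_apply_of]
        set h := g * (val (FreeGroup.mk u))⁻¹
        have h4 := hb (h * (s i)⁻¹) i
        rw [inv_mul_cancel_right] at h4
        simp only [σ, Equiv.coe_fn_mk, Prod.mk.injEq, true_and]
        rw [← h4, h0]
        generalize a g = A
        generalize a h = B
        generalize a (h * (s i)⁻¹) = C
        clear h2
        revert c A B C
        decide
      | false =>
        have h3 : (FreeGroup.mk [(i, false)] : FreeGroup ι) = (FreeGroup.of i)⁻¹ := rfl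
        rw [h1, h3, map_mul val, map_inv val, hvi, mul_inv_rev, inv_inv, ← mul_assoc] at h0 ⊢
        rw [map_mul, Equiv.Perm.mul_apply, h2, map_inv, FreeGroup.lift_apply_of]
        set h := g * (val (FreeGroup.mk u))⁻¹
        simp only [Equiv.Perm.inv_def, σ, Equiv.coe_fn_symm_mk, Prod.mk.injEq, true_and]
        rw [h0]
        generalize a g = A
        generalize a h = B
        generalize a (h * (s i)) = C
        clear h2
        revert c A B C
        decide
  have hrel : ∀ r ∈ rels, FreeGroup.lift σ r = 1 := by
    intro r hr
    ext1 ⟨g, c⟩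
    obtain ⟨a, ha⟩ := hloc g
    have h1 := hsuf g a r hr (fun u i ε => ha r hr u i ε) r.toWord List.suffix_rfl c
    have h2 : val r = 1 := by
      rw [hval, PresentedGroup.one_of_mem hr, map_one]
    rw [FreeGroup.mk_toWord, h2] at h1
    rw [h1]
    simp [add_assoc, two]
  let Ψ : G →* Equiv.Perm (G × ZMod 2) :=
    (PresentedGroup.toGroup hrel).comp e.symm.toMonoidHom
  have hΨ : ∀ i, Ψ (s i) = σ i := by
    intro i
    change PresentedGroup.toGroup hrel (e.symm (s i)) = σ i
    rw [hs, e.symm_apply_apply, PresentedGroup.toGroup.of]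
  have hgen : ∀ (γ : G) p, (Ψ γ p).1 = p.1 * γ⁻¹ := by
    intro γ
    obtain ⟨x, rfl⟩ : ∃ x, val x = γ := by
      obtain ⟨y, rfl⟩ := e.surjective γ
      obtain ⟨x, rfl⟩ := PresentedGroup.mk_surjective rels y
      exact ⟨x, rfl⟩
    induction x using FreeGroup.induction_on with
    | C1 => simp
    | of i =>
      intro p
      rw [hvi, hΨ]
      rfl
    | inv_of i _ =>
      intro p
      rw [map_inv, map_inv, hvi, hΨ, inv_inv]
      rfl
    | mul x y hx hy =>
      intro p
      rw [map_mul, map_mul, Equiv.Perm.mul_apply, hx, hy, mul_inv_rev, mul_assoc]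
  refine ⟨fun g => (Ψ g⁻¹ (1, 0)).2, fun g i => ?_⟩
  have h1 : Ψ g⁻¹ (1, 0) = σ i (Ψ (g * s i)⁻¹ (1, 0)) := by
    rw [← hΨ, ← Equiv.Perm.mul_apply, ← map_mul]
    congr 2
    group
  have h2 := congrArg Prod.snd h1
  have h3 := hgen (g * s i)⁻¹ (1, 0)
  change _ = (Ψ (g * s i)⁻¹ (1, 0)).2 + b ((Ψ (g * s i)⁻¹ (1, 0)).1 * (s i)⁻¹)
    (Ψ (g * s i)⁻¹ (1, 0)).1 at h2
  rw [h3] at h2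
  simp only [one_mul, inv_inv, mul_inv_cancel_right] at h2
  show _ = (Ψ g⁻¹ (1, 0)).2 + (Ψ (g * s i)⁻¹ (1, 0)).2
  rw [h2]
  generalize (Ψ (g * s i)⁻¹ (1, 0)).2 = A
  generalize b g (g * s i) = B
  revert A B
  decide

/-- In a tree, a finite set lies in a finite convex set. -/
theorem SimpleGraph.IsTree.exists_finite_convex {V : Type*} {Γ : SimpleGraph V} (h : Γ.IsTree)
    {F : Set V} (hF : F.Finite) : ∃ D, F ⊆ D ∧ D.Finite ∧ Γ.GeodConvex D := by
  obtain ⟨x⟩ := h.connected.nonempty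
  let I : V → Set V := fun p => {m | Γ.dist x m + Γ.dist m p = Γ.dist x p}
  refine ⟨⋃ p ∈ F, I p, fun p hp => ?_, hF.biUnion fun p _ => h.interval_finite x p, ?_⟩
  · simp only [Set.mem_iUnion]
    exact ⟨p, hp, by simp [I]⟩
  · apply h.geodConvex_of_crossing
    intro P a ha b hb hPa hPb
    simp only [Set.mem_iUnion] at ha hb
    obtain ⟨p, hp, ha⟩ := ha
    obtain ⟨q, hq, hb⟩ := hb
    have hx : ∀ p, x ∈ I p := fun p => by simp [I]
    have key : ∀ p ∈ F, ∀ a ∈ I p, ∀ b ∈ I p, P a → ¬ P b →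
        ∃ u ∈ ⋃ p ∈ F, I p, ∃ v ∈ ⋃ p ∈ F, I p, Γ.Adj u v ∧ P u ∧ ¬ P v := by
      intro p hp a ha b hb hPa hPb
      have hc := h.connected_of_geodConvex (h.interval_convex x p) ⟨x, hx p⟩
      obtain ⟨u, v, huv, hu, hv⟩ :=
        (hc.preconnected ⟨a, ha⟩ ⟨b, hb⟩).exists_adj_crossing (fun y => P y.1) hPa hPb
      exact ⟨u, Set.mem_biUnion hp u.2, v, Set.mem_biUnion hp v.2, huv, hu, hv⟩
    by_cases hPx : P x
    · exact key q hq x (hx q) b hb hPx hPb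
    · exact key p hp a ha x (hx p) hPa hPx

theorem FinitelyPresentedGroup.fg {G : Type*} [Group G] (h : FinitelyPresentedGroup G) :
    Group.FG G := by
  obtain ⟨n, rels, -, ⟨e⟩⟩ := h
  exact Group.fg_of_surjective (f := e.toMonoidHom.comp (PresentedGroup.mk rels))
    (e.surjective.comp (PresentedGroup.mk_surjective rels))

/-- Dunwoody resolution: a tree with an action of a finitely presented group is dominated by one
whose edge stabilizers are finitely generated. -/
theorem IsTreeAction.exists_resolution {G : Type u} [Group G] (hG : FinitelyPresentedGroup G)
    {V : Type u} [MulAction G V] {Γ : SimpleGraph V} (hS : IsTreeAction G Γ) :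
    ∃ (V' : Type u) (_ : MulAction G V') (Γ' : SimpleGraph V') (f : V' → V), IsTreeAction G Γ' ∧
      (∀ (g : G) v, f (g • v) = g • f v) ∧ (∀ a b, Γ'.Adj a b → Γ.Adj (f a) (f b)) ∧
      ∀ a b, Γ'.Adj a b → (MulAction.stabilizer G a ⊓ MulAction.stabilizer G b).FG := by
  obtain ⟨n, rels, hrels, ⟨e⟩⟩ := hG
  obtain ⟨x⟩ := hS.isTree.connected.nonempty
  let s : Fin n → G := fun i => e (PresentedGroup.of i)
  let val : List (Fin n × Bool) → G := fun u => e (PresentedGroup.mk rels (FreeGroup.mk u))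
  let F : Set V := {x} ∪ Set.range (fun i => (s i)⁻¹ • x) ∪
    ⋃ r ∈ rels, (fun u => val u • x) '' {u | u <:+ r.toWord}
  have hF : F.Finite := by
    refine ((Set.finite_singleton x).union (Set.finite_range _)).union
      (hrels.biUnion fun r _ => Set.Finite.image _ ?_)
    refine (List.finite_toSet r.toWord.tails).subset fun u hu => ?_
    exact (List.mem_tails _ _).2 hu
  obtain ⟨D, hFD, hD, hDc⟩ := hS.isTree.exists_finite_convex hF
  have hx : x ∈ D := hFD (Or.inl (Or.inl rfl))
  have hsx : ∀ i, (s i)⁻¹ • x ∈ D := fun i => hFD (Or.inl (Or.inr ⟨i, rfl⟩))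
  have hvx : ∀ r ∈ rels, ∀ u, u <:+ r.toWord → val u • x ∈ D := fun r hr u hu =>
    hFD (Or.inr (Set.mem_biUnion hr ⟨u, hu, rfl⟩))
  have hconv : ∀ g : G, Γ.GeodConvex {t | g⁻¹ • t ∈ D} := by
    intro g a ha b hb m hm
    refine hDc _ ha _ hb _ ?_
    rw [hS.dist_smul, hS.dist_smul, hS.dist_smul, hm]
  let d : GlueData G G Γ :=
    { D := fun g => {t | g⁻¹ • t ∈ D}
      DE := fun g k => {t | (∃ i, k = g * s i ∨ g = k * s i) ∧ g⁻¹ • t ∈ D ∧ k⁻¹ • t ∈ D}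
      D_convex := hconv
      D_nonempty := fun g => ⟨g • x, by simpa using hx⟩
      D_smul := fun g v t ht => by simpa [mul_smul] using ht
      DE_subset := fun g k t ht => ht.2.1
      DE_symm := fun g k t ⟨⟨i, hi⟩, h1, h2⟩ => ⟨⟨i, hi.symm⟩, h2, h1⟩
      DE_smul := fun g v w t ⟨⟨i, hi⟩, h1, h2⟩ =>
        ⟨⟨i, by simpa [mul_assoc] using hi⟩, by simpa [mul_smul] using h1,
          by simpa [mul_smul] using h2⟩
      DE_convex := fun g k a ha b hb m hm =>
        ⟨ha.1, hconv g a ha.2.1 b hb.2.1 m hm, hconv k a ha.2.2 b hb.2.2 m hm⟩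
      conn := ?_
      simplyConn := ?_ }
  rotate_left
  · have step : ∀ g i, (({t | (∃ j, g * s i = g * s j ∨ g = g * s i * s j) ∧ g⁻¹ • t ∈ D ∧
        (g * s i)⁻¹ • t ∈ D} : Set V)).Nonempty := fun g i =>
      ⟨g • x, ⟨i, Or.inl rfl⟩, by simpa using hx, by simpa [mul_smul] using hsx i⟩
    have step' : ∀ g i, (({t | (∃ j, g * (s i)⁻¹ = g * s j ∨ g = g * (s i)⁻¹ * s j) ∧ g⁻¹ • t ∈ D ∧
        (g * (s i)⁻¹)⁻¹ • t ∈ D} : Set V)).Nonempty := fun g i => by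
      obtain ⟨t, -, h1, h2⟩ := step (g * (s i)⁻¹) i
      exact ⟨t, ⟨i, Or.inr (by simp)⟩, by simpa using h2, h1⟩
    have key : ∀ y : FreeGroup (Fin n), ∀ g, Relation.ReflTransGen (fun g k : G =>
        ({t | (∃ i, k = g * s i ∨ g = k * s i) ∧ g⁻¹ • t ∈ D ∧ k⁻¹ • t ∈ D} : Set V).Nonempty)
        g (g * e (PresentedGroup.mk rels y)) := by
      intro y
      induction y using FreeGroup.induction_on with
      | C1 =>
        intro g
        rw [map_one, map_one, mul_one]
      | of i => exact fun g => Relation.ReflTransGen.single (step g i)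
      | inv_of i _ =>
        intro g
        rw [map_inv, map_inv]
        exact Relation.ReflTransGen.single (step' g i)
      | mul y z hy hz =>
        intro g
        rw [map_mul, map_mul, ← mul_assoc]
        exact (hy g).trans (hz _)
    intro v w
    obtain ⟨z, hz⟩ := e.surjective (v⁻¹ * w)
    obtain ⟨y, rfl⟩ := PresentedGroup.mk_surjective rels z
    have := key y v
    rwa [hz, mul_inv_cancel_left] at this
  · intro b hb
    have hsym : ∀ t v w, ((∃ i, w = v * s i ∨ v = w * s i) ∧ v⁻¹ • t ∈ D ∧ w⁻¹ • t ∈ D) →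
        b w v = b v w := by
      intro t v w h
      obtain ⟨a, ha⟩ := hb t
      rw [ha v w h, ha w v ⟨h.1.imp fun _ h => h.symm, h.2.2, h.2.1⟩, add_comm]
    obtain ⟨a, ha⟩ := exists_potential_of_presentation e s (fun _ => rfl) b
      (fun g i => hsym (g • x) g (g * s i) ⟨⟨i, Or.inl rfl⟩, by simpa using hx,
        by simpa [mul_smul] using hsx i⟩) (by
        intro g
        obtain ⟨a, ha⟩ := hb (g • x)
        refine ⟨a, fun r hr u i ε hu h k hh hk => ha h k ⟨⟨i, ?_⟩, ?_, ?_⟩⟩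
        · have h1 : FreeGroup.mk ((i, ε) :: u) = FreeGroup.mk [(i, ε)] * FreeGroup.mk u := by
            simp [FreeGroup.mul_mk]
          rw [h1, map_mul, map_mul, mul_inv_rev, ← mul_assoc, ← hh] at hk
          cases ε with
          | true =>
            right
            change k = h * (s i)⁻¹ at hk
            rw [hk, inv_mul_cancel_right]
          | false =>
            left
            have h3 : (FreeGroup.mk [(i, false)] : FreeGroup (Fin n)) = (FreeGroup.of i)⁻¹ := rfl
            rw [h3, map_inv, map_inv, inv_inv] at hk
            exact hk
        · rw [hh, mul_inv_rev, inv_inv, mul_smul, inv_smul_smul]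
          exact hvx r hr u ((List.suffix_cons _ _).trans hu)
        · rw [hk, mul_inv_rev, inv_inv, mul_smul, inv_smul_smul]
          exact hvx r hr _ hu)
    refine ⟨a, fun v w hvw => ?_⟩
    obtain ⟨t, ht⟩ := hvw
    obtain ⟨i, rfl | rfl⟩ := ht.1
    · exact ha v i
    · rw [← hsym t _ _ ht, ha w i, add_comm]
  refine ⟨d.Q, inferInstance, d.graph, GlueData.proj, d.isTreeAction hS, GlueData.proj_smul,
    fun _ _ h => GlueData.adj_proj h, ?_⟩
  intro a b hadj
  obtain ⟨v, t, t', k, k', htt, rfl, rfl⟩ := GlueData.exists_of_adj hadj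
  have hmem : ∀ c, d.Linked₂ t t' v c → c⁻¹ • t ∈ D ∧ c⁻¹ • t' ∈ D := by
    intro c hc
    cases hc with
    | refl => exact ⟨k, k'⟩
    | tail _ h => exact ⟨h.1.2.2, h.2.2.2⟩
  refine Subgroup.fg_of_cofinite _ {c | d.Linked₂ t t' v c}
    (Set.range s ∪ Set.range fun i => (s i)⁻¹)
    ((Set.finite_range _).union (Set.finite_range _)) (fun c => (c⁻¹ • t, c⁻¹ • t')) ?_
    (g₀ := v) Relation.ReflTransGen.refl ?_ ?_ ?_
  · refine (hD.prod hD).subset ?_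
    rintro _ ⟨c, hc, rfl⟩
    exact ⟨(hmem c hc).1, (hmem c hc).2⟩
  · intro c hc
    have hc' : d.Linked₂ t t' v c := hc
    clear hc
    induction hc' with
    | refl => exact Relation.ReflTransGen.refl
    | @tail c c' h1 h2 ih =>
      refine ih.tail ⟨h1.tail h2, ?_⟩
      obtain ⟨i, hi | hi⟩ := h2.1.1
      · exact ⟨s i, Or.inl ⟨i, rfl⟩, hi⟩
      · exact ⟨(s i)⁻¹, Or.inr ⟨i, rfl⟩, by rw [hi, mul_inv_cancel_right]⟩
  · intro c hc c' hc' hτ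
    have e1 : c⁻¹ • t = c'⁻¹ • t := congrArg Prod.fst hτ
    have e2 : c⁻¹ • t' = c'⁻¹ • t' := congrArg Prod.snd hτ
    have f1 : (c' * c⁻¹) • t = t := by rw [mul_smul, e1, smul_inv_smul]
    have f2 : (c' * c⁻¹) • t' = t' := by rw [mul_smul, e2, smul_inv_smul]
    have hl := GlueData.Linked₂.smul hc (c' * c⁻¹)
    rw [f1, f2, smul_eq_mul, smul_eq_mul, inv_mul_cancel_right] at hl
    have hl' : d.Linked₂ t t' v ((c' * c⁻¹) • v) := Relation.ReflTransGen.trans hc' hl.symm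
    exact ⟨GlueData.fixes_of_linked k f1 hl'.left, GlueData.fixes_of_linked k' f2 hl'.right⟩
  · rintro h ⟨h1, h2⟩
    have hl := GlueData.linked₂_of_fixes hS.isTree k k' htt h1 h2
    have p1 : h • t = t := by
      have := congrArg GlueData.proj h1
      rwa [GlueData.proj_smul] at this
    have p2 : h • t' = t' := by
      have := congrArg GlueData.proj h2
      rwa [GlueData.proj_smul] at this
    refine ⟨hl, ?_⟩
    have q1 : h⁻¹ • t = t := inv_smul_eq_iff.2 p1.symm
    have q2 : h⁻¹ • t' = t' := inv_smul_eq_iff.2 p2.symm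
    rw [mul_inv_rev, mul_smul, mul_smul, q1, q2]

namespace IsTreeAction

variable {G : Type u} [Group G] {V : Type u} [MulAction G V] {Γ : SimpleGraph V}

/-- Collapsing an invariant set `O` of edges. -/
theorem exists_collapse (hS : IsTreeAction G Γ) (O : V → V → Prop) (hsymm : ∀ a b, O a b → O b a)
    (hinv : ∀ (g : G) a b, O a b → O (g • a) (g • b)) :
    ∃ (V' : Type u) (_ : MulAction G V') (Γ' : SimpleGraph V') (f : V → V'), IsTreeAction G Γ' ∧
      (∀ (g : G) v, f (g • v) = g • f v) ∧ Function.Surjective f ∧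
      (∀ q, Γ.GeodConvex (f ⁻¹' {q})) ∧ (∀ a b, Γ.Adj a b → O a b → f a = f b) ∧
      (∀ a b, Γ.Adj a b → ¬ O a b → f a ≠ f b) ∧
      ∀ q q', Γ'.Adj q q' → ∃ a b, Γ.Adj a b ∧ ¬ O a b ∧ f a = q ∧ f b = q' ∧
        MulAction.stabilizer G q ⊓ MulAction.stabilizer G q' =
          MulAction.stabilizer G a ⊓ MulAction.stabilizer G b := by
  let Θ : SimpleGraph V :=
    { Adj := fun a b => Γ.Adj a b ∧ O a b
      symm := ⟨fun a b (h : Γ.Adj a b ∧ O a b) => ⟨h.1.symm, hsymm a b h.2⟩⟩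
      loopless := ⟨fun a (h : Γ.Adj a a ∧ O a a) => Γ.loopless.irrefl a h.1⟩ }
  have hΘ : ∀ g : G, ∀ a b, Θ.Reachable a b → Θ.Reachable (g • a) (g • b) := fun g a b h =>
    h.map (G' := Θ) ⟨fun v => g • v, fun {a b} (h : Θ.Adj a b) =>
      ⟨hS.adj g a b h.1, hinv g a b h.2⟩⟩
  let st : Setoid V := Θ.reachableSetoid
  let Q := Quotient st
  let f : V → Q := Quotient.mk st
  have hf : ∀ a b, f a = f b ↔ Θ.Reachable a b := fun a b => Quotient.eq (r := st)
  have hfs : Function.Surjective f := Quotient.mk_surjective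
  let _ : MulAction G Q :=
    { smul := fun g => Quotient.map (fun v => g • v) (fun a b h => hΘ g a b h)
      one_smul := fun q => by
        obtain ⟨v, rfl⟩ := hfs q
        exact congrArg f (one_smul G v)
      mul_smul := fun g h q => by
        obtain ⟨v, rfl⟩ := hfs q
        exact congrArg f (mul_smul g h v) }
  have hfe : ∀ (g : G) v, f (g • v) = g • f v := fun _ _ => rfl
  -- a surviving edge separates the quotient
  have side : ∀ a b, Γ.Adj a b → ¬ O a b → ∀ u v, f u = f v →
      Γ.dist u a < Γ.dist u b → Γ.dist v a < Γ.dist v b := by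
    intro a b hab hO u v huv hu
    by_contra hv
    obtain ⟨x, y, hxy, hx, hy⟩ := ((hf u v).1 huv).exists_adj_crossing
      (fun z => Γ.dist z a < Γ.dist z b) hu hv
    obtain ⟨rfl, rfl⟩ := hS.isTree.eq_of_side hab hxy.1 hx hy
    exact hO hxy.2
  have ha0 : ∀ a b, Γ.Adj a b → Γ.dist a a < Γ.dist a b := by
    intro a b hab
    rw [SimpleGraph.dist_eq_one_iff_adj.2 hab, SimpleGraph.dist_self]
    exact one_pos
  have hb0 : ∀ a b, Γ.Adj a b → ¬ Γ.dist b a < Γ.dist b b := by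
    intro a b hab
    rw [SimpleGraph.dist_self]
    exact Nat.not_lt_zero _
  have hne : ∀ a b, Γ.Adj a b → ¬ O a b → f a ≠ f b := fun a b hab hO h =>
    hb0 a b hab (side a b hab hO a b h (ha0 a b hab))
  let Δ : SimpleGraph Q :=
    { Adj := fun q q' => ∃ a b, Γ.Adj a b ∧ ¬ O a b ∧ f a = q ∧ f b = q'
      symm := ⟨fun q q' ⟨a, b, h1, h2, h3, h4⟩ =>
        ⟨b, a, h1.symm, fun h => h2 (hsymm _ _ h), h4, h3⟩⟩
      loopless := ⟨fun q ⟨a, b, h1, h2, h3, h4⟩ => hne a b h1 h2 (h3.trans h4.symm)⟩ }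
  have hfO : ∀ a b, Γ.Adj a b → O a b → f a = f b := fun a b hab hO =>
    (hf a b).2 (SimpleGraph.Adj.reachable ⟨hab, hO⟩)
  -- the edges of the quotient which separate are images of the given edge
  have cross : ∀ a b, Γ.Adj a b → ¬ O a b → ∀ u v, Γ.Adj u v → ∀ x y, f x = f u → f y = f v →
      Γ.dist x a < Γ.dist x b → ¬ Γ.dist y a < Γ.dist y b → u = a ∧ v = b := by
    intro a b hab hO u v huv x y hx hy hxa hya
    exact hS.isTree.eq_of_side hab huv (side a b hab hO x u hx hxa)
      fun h => hya (side a b hab hO v y hy.symm h)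
  have hfix : ∀ a b, Γ.Adj a b → ¬ O a b → ∀ g : G, g • f a = f a → g • f b = f b →
      g • a = a ∧ g • b = b := by
    intro a b hab hO g h1 h2
    exact cross a b hab hO (g • a) (g • b) (hS.adj g a b hab) a b h1.symm h2.symm
      (ha0 a b hab) (hb0 a b hab)
  have : Nonempty Q := ⟨f hS.isTree.connected.nonempty.some⟩
  refine ⟨Q, inferInstance, Δ, f, ⟨⟨⟨fun q q' => ?_⟩, ?_⟩, ?_, ?_⟩, hfe, hfs, ?_, hfO, hne, ?_⟩
  · obtain ⟨a, rfl⟩ := hfs q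
    obtain ⟨b, rfl⟩ := hfs q'
    obtain ⟨p⟩ := hS.isTree.connected.preconnected a b
    induction p with
    | nil => rfl
    | @cons u v w huv _ ih =>
      by_cases hO : O u v
      · rwa [hfO u v huv hO]
      · exact (SimpleGraph.Adj.reachable (G := Δ) ⟨u, v, huv, hO, rfl, rfl⟩).trans ih
  · rw [SimpleGraph.isAcyclic_iff_forall_adj_isBridge]
    rintro _ _ ⟨a, b, hab, hO, rfl, rfl⟩
    rw [SimpleGraph.isBridge_iff]
    intro hr
    obtain ⟨x, y, hxy, ⟨x', hx', hx⟩, hy⟩ := hr.exists_adj_crossing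
      (fun q => ∃ x, f x = q ∧ Γ.dist x a < Γ.dist x b) ⟨a, rfl, ha0 a b hab⟩
      (fun ⟨z, hz, hz'⟩ => hb0 a b hab (side a b hab hO z b hz hz'))
    rw [SimpleGraph.deleteEdges_adj] at hxy
    obtain ⟨⟨u, v, huv, -, rfl, rfl⟩, hn⟩ := hxy
    obtain ⟨rfl, rfl⟩ := cross a b hab hO u v huv x' v hx' rfl hx fun h => hy ⟨v, rfl, h⟩
    exact hn rfl
  · rintro g _ _ ⟨a, b, hab, hO, rfl, rfl⟩
    refine ⟨g • a, g • b, hS.adj g a b hab, fun h => hO ?_, rfl, rfl⟩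
    have := hinv g⁻¹ _ _ h
    rwa [inv_smul_smul, inv_smul_smul] at this
  · rintro g _ _ ⟨a, b, hab, hO, rfl, rfl⟩ ⟨h1, h2⟩
    obtain ⟨e1, e2⟩ := cross a b hab hO (g • b) (g • a) (hS.adj g b a hab.symm) a b h2.symm h1.symm
      (ha0 a b hab) (hb0 a b hab)
    exact hS.noInv g a b hab ⟨e2, e1⟩
  · intro q
    apply hS.isTree.geodConvex_of_crossing
    rintro P a rfl b hb hPa hPb
    obtain ⟨u, v, huv, ⟨hu, hPu⟩, hv⟩ := ((hf a b).1 hb.symm).exists_adj_crossing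
      (fun z => f z = f a ∧ P z) ⟨rfl, hPa⟩ fun h => hPb h.2
    have hva : f v = f a := by rw [← hfO u v huv.1 huv.2, hu]
    exact ⟨u, hu, v, hva, huv.1, hPu, fun h => hv ⟨hva, h⟩⟩
  · rintro _ _ ⟨a, b, hab, hO, rfl, rfl⟩
    refine ⟨a, b, hab, hO, rfl, rfl, le_antisymm ?_ ?_⟩
    · rintro g ⟨h1, h2⟩
      exact hfix a b hab hO g h1 h2
    · rintro g ⟨h1, h2⟩
      exact ⟨congrArg f h1, congrArg f h2⟩

/-- A group which is elliptic in two complementary collapses is elliptic. -/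
theorem exists_complementary_collapses (hS : IsTreeAction G Γ) (O : V → V → Prop)
    (hsymm : ∀ a b, O a b → O b a) (hinv : ∀ (g : G) a b, O a b → O (g • a) (g • b)) :
    ∃ (V₁ : Type u) (_ : MulAction G V₁) (Γ₁ : SimpleGraph V₁)
      (V₂ : Type u) (_ : MulAction G V₂) (Γ₂ : SimpleGraph V₂),
      IsTreeAction G Γ₁ ∧ IsTreeAction G Γ₂ ∧
      (∀ q q', Γ₁.Adj q q' → ∃ a b, Γ.Adj a b ∧ O a b ∧
        MulAction.stabilizer G q ⊓ MulAction.stabilizer G q' =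
          MulAction.stabilizer G a ⊓ MulAction.stabilizer G b) ∧
      (∀ q q', Γ₂.Adj q q' → ∃ a b, Γ.Adj a b ∧ ¬ O a b ∧
        MulAction.stabilizer G q ⊓ MulAction.stabilizer G q' =
          MulAction.stabilizer G a ⊓ MulAction.stabilizer G b) ∧
      ∀ H : Subgroup G, HasFixedPoint H V₁ → HasFixedPoint H V₂ → HasFixedPoint H V := by
  obtain ⟨V₁, _, Γ₁, f₁, h₁, he₁, hs₁, hc₁, -, hn₁, hg₁⟩ :=
    hS.exists_collapse (fun a b => ¬ O a b) (fun a b h h' => h (hsymm _ _ h'))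
      (fun g a b h h' => h (by simpa using hinv g⁻¹ _ _ h'))
  obtain ⟨V₂, _, Γ₂, f₂, h₂, he₂, hs₂, hc₂, -, hn₂, hg₂⟩ := hS.exists_collapse O hsymm hinv
  refine ⟨V₁, inferInstance, Γ₁, V₂, inferInstance, Γ₂, h₁, h₂,
    fun q q' hq => ?_, fun q q' hq => ?_,
    ?_⟩
  · obtain ⟨a, b, hab, hO, -, -, h⟩ := hg₁ q q' hq
    exact ⟨a, b, hab, not_not.1 hO, h⟩
  · obtain ⟨a, b, hab, hO, -, -, h⟩ := hg₂ q q' hq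
    exact ⟨a, b, hab, hO, h⟩
  · rintro H ⟨q₁, hq₁⟩ ⟨q₂, hq₂⟩
    obtain ⟨w, -, hw⟩ := hS.hasFixedPoint_of_invariant_pair (H := H) (hc₁ q₁) (hc₂ q₂)
      (hs₁ q₁) (hs₂ q₂)
      (fun h hh y hy => by
        change f₁ (h • y) = q₁
        rw [he₁, show f₁ y = q₁ from hy, hq₁ h hh])
      (fun h hh y hy => by
        change f₂ (h • y) = q₂
        rw [he₂, show f₂ y = q₂ from hy, hq₂ h hh])
      (by
        rintro a ⟨ha₁, ha₂⟩ b ⟨hb₁, hb₂⟩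
        by_contra hne
        obtain ⟨c, hac, hd⟩ := hS.isTree.exists_first_edge hne
        have hd1 := SimpleGraph.dist_eq_one_iff_adj.2 hac
        have c₁ : f₁ c = q₁ := hc₁ q₁ a ha₁ b hb₁ c (by omega)
        have c₂ : f₂ c = q₂ := hc₂ q₂ a ha₂ b hb₂ c (by omega)
        by_cases hO : O a c
        · exact hn₁ a c hac (not_not.2 hO) (ha₁.trans c₁.symm)
        · exact hn₂ a c hac hO (ha₂.trans c₂.symm))
    exact ⟨w, hw⟩

end IsTreeAction

/-- `E` contains no copy of `ℤᵐ` with `m ≥ n`. -/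
def FreeRankLT {G : Type*} [Group G] (n : ℕ) (E : Subgroup G) : Prop :=
  ∀ m ≥ n, ∀ φ : Multiplicative (Fin m → ℤ) →* G, (∀ x, φ x ∈ E) → ¬ Function.Injective φ

namespace FreeRankLT

variable {G : Type*} [Group G] {E F : Subgroup G}

theorem not_zero : ¬ FreeRankLT 0 E := fun h =>
  h 0 le_rfl 1 (fun _ => E.one_mem) (Function.injective_of_subsingleton _)

theorem mono {m n : ℕ} (h : FreeRankLT m E) (hmn : m ≤ n) : FreeRankLT n E := fun k hk =>
  h k (hmn.trans hk)

theorem of_conj {n : ℕ} (h : FreeRankLT n F) (g : G) (hg : ∀ x ∈ E, g * x * g⁻¹ ∈ F) :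
    FreeRankLT n E := fun m hm φ hφ hinj =>
  h m hm ((MulAut.conj g).toMonoidHom.comp φ) (fun x => hg _ (hφ x))
    ((MulAut.conj g).injective.comp hinj)

theorem of_elliptic {V : Type*} [MulAction G V] {Γ : SimpleGraph V} (hS : IsTreeAction G Γ) {n : ℕ}
    (h : FreeRankLT (n + 1) E) (hab : AbelianSubgroup E) (hE : E.FG) (hEV : ¬ HasFixedPoint E V)
    (hFE : F ≤ E) (hF : HasFixedPoint F V) : FreeRankLT n F := by
  intro m hm φ hφ hinj
  obtain ⟨g, hgE, hg⟩ : ∃ g ∈ E, ∀ w : V, g • w ≠ w := by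
    by_contra! hno
    exact hEV (hS.hasFixedPoint_of_fg hE hno)
  have hcomm : ∀ y (k : ℤ), g ^ k * φ y = φ y * g ^ k := fun y k =>
    hab _ (E.zpow_mem hgE k) _ (hFE (hφ y))
  let tl : (Fin (m + 1) → ℤ) → Multiplicative (Fin m → ℤ) := fun x =>
    Multiplicative.ofAdd fun i => x i.succ
  let ψ : Multiplicative (Fin (m + 1) → ℤ) →* G :=
    { toFun := fun x => g ^ (x.toAdd 0) * φ (tl x.toAdd)
      map_one' := by
        have : tl 0 = 1 := rfl
        simp [this]
      map_mul' := fun x y => by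
        have : tl (x * y).toAdd = tl x.toAdd * tl y.toAdd := rfl
        have h' : (x * y).toAdd 0 = x.toAdd 0 + y.toAdd 0 := rfl
        rw [this, map_mul φ, h', zpow_add]
        rw [mul_assoc, mul_assoc, ← mul_assoc (g ^ y.toAdd 0), hcomm, mul_assoc] }
  refine h (m + 1) (by omega) ψ (fun x => E.mul_mem (E.zpow_mem hgE _) (hFE (hφ _))) ?_
  rw [injective_iff_map_eq_one]
  intro x hx
  change g ^ (x.toAdd 0) * φ (tl x.toAdd) = 1 at hx
  have h0 : x.toAdd 0 = 0 := by
    by_contra hne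
    obtain ⟨w, hw⟩ := hF
    have h1 : g ^ (x.toAdd 0) ∈ F := by
      rw [eq_inv_of_mul_eq_one_left hx]
      exact F.inv_mem (hφ _)
    have h2 : g ^ (x.toAdd 0).natAbs ∈ F := by
      rcases Int.natAbs_eq (x.toAdd 0) with h3 | h3
      · rwa [h3, zpow_natCast] at h1
      · rw [h3, zpow_neg, zpow_natCast] at h1
        exact inv_mem_iff.1 h1
    exact hS.hyperbolic_pow hg (Int.natAbs_pos.2 hne) w (hw _ h2)
  rw [h0, zpow_zero, one_mul] at hx
  have h1 : tl x.toAdd = 1 := hinj (hx.trans (map_one φ).symm)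
  apply Multiplicative.toAdd.injective
  funext i
  refine Fin.cases h0 (fun j => ?_) i
  exact congrFun (congrArg Multiplicative.toAdd h1) j

end FreeRankLT

theorem AbelianSubgroup.slender {G : Type*} [Group G] {E : Subgroup G} (hab : AbelianSubgroup E)
    (hE : E.FG) : SlenderSubgroup E := by
  intro K hK
  let _ : CommGroup E := { (inferInstance : Group E) with
    mul_comm := fun a b => Subtype.ext (hab a a.2 b b.2) }
  have h1 : Group.FG E := (Group.fg_iff_subgroup_fg E).2 hE
  have h2 : Module.Finite ℤ (Additive E) := Module.Finite.iff_addGroup_fg.2 inferInstance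
  have h3 : IsNoetherian ℤ (Additive E) := inferInstance
  have h4 := h3.noetherian (AddSubgroup.toIntSubmodule (Subgroup.toAddSubgroup (K.subgroupOf E)))
  have h5 : (K.subgroupOf E).FG := by
    rw [Subgroup.fg_iff_add_fg]
    rw [Submodule.fg_iff_addSubgroup_fg] at h4
    exact h4
  have h6 : Group.FG (K.subgroupOf E) := (Group.fg_iff_subgroup_fg _).2 h5
  exact (Group.fg_iff_subgroup_fg K).1 (Group.fg_of_surjective
    (f := (Subgroup.subgroupOfEquivOfLe hK).toMonoidHom)
    (Subgroup.subgroupOfEquivOfLe hK).surjective)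

theorem AbelianSubgroup.exists_freeRankLT {G : Type*} [Group G] {E : Subgroup G}
    (hab : AbelianSubgroup E) (hE : E.FG) : ∃ n, FreeRankLT n E := by
  let _ : CommGroup E := { (inferInstance : Group E) with
    mul_comm := fun a b => Subtype.ext (hab a a.2 b b.2) }
  have h1 : Group.FG E := (Group.fg_iff_subgroup_fg E).2 hE
  have h2 : Module.Finite ℤ (Additive E) := Module.Finite.iff_addGroup_fg.2 inferInstance
  refine ⟨Module.finrank ℤ (Additive E) + 1, fun m hm φ hφ hinj => ?_⟩
  let ψ : Multiplicative (Fin m → ℤ) →* E := φ.codRestrict E hφ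
  have hψ : Function.Injective ψ := fun x y h => hinj (congrArg Subtype.val h)
  let L : (Fin m → ℤ) →ₗ[ℤ] Additive E := (MonoidHom.toAdditiveRight ψ).toIntLinearMap
  have hL : Function.Injective L := hψ
  have := LinearMap.finrank_le_finrank_of_injective hL
  rw [Module.finrank_fin_fun] at this
  omega

theorem IsTreeAction.exists_gtree {G : Type u} [Group G] [Group.FG G] {V : Type u} [MulAction G V]
    {Γ : SimpleGraph V} (hS : IsTreeAction G Γ) :
    ∃ T : GTree G, (∀ a b, T.graph.Adj a b → ∃ a' b', Γ.Adj a' b' ∧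
      T.edgeStab a b = MulAction.stabilizer G a' ⊓ MulAction.stabilizer G b') ∧
      ∀ H : Subgroup G, T.EllipticSubgroup H ↔ HasFixedPoint H V := by
  obtain ⟨T, f, hf, hfe, hadj, hell⟩ := hS.exists_minimal_subtree
  have key : ∀ a, MulAction.stabilizer G (f a) = MulAction.stabilizer G a := by
    intro a
    ext g
    rw [MulAction.mem_stabilizer_iff, MulAction.mem_stabilizer_iff, ← hfe, hf.eq_iff]
  refine ⟨T, fun a b hab => ⟨f a, f b, (hadj a b).1 hab, ?_⟩, hell⟩
  rw [key, key, GTree.edgeStab_eq]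

theorem HasFixedPoint.map {G : Type*} [Group G] {H : Subgroup G} {V W : Type*} [MulAction G V]
    [MulAction G W] (h : HasFixedPoint H V) (f : V → W) (hf : ∀ (g : G) v, f (g • v) = g • f v) :
    HasFixedPoint H W :=
  let ⟨w, hw⟩ := h
  ⟨f w, fun g hg => by rw [← hf, hw g hg]⟩

theorem HasFixedPoint.smul {G : Type*} [Group G] {V W : Type*} [MulAction G V] [MulAction G W]
    {a b : V} (h : HasFixedPoint (MulAction.stabilizer G a ⊓ MulAction.stabilizer G b) W) (g : G) :
    HasFixedPoint (MulAction.stabilizer G (g • a) ⊓ MulAction.stabilizer G (g • b)) W := by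
  obtain ⟨w, hw⟩ := h
  refine ⟨g • w, ?_⟩
  rintro x ⟨h1, h2⟩
  have h1 : x • g • a = g • a := h1
  have h2 : x • g • b = g • b := h2
  have := hw (g⁻¹ * x * g) ⟨by
    change (g⁻¹ * x * g) • a = a
    rw [mul_smul, mul_smul, h1, inv_smul_smul], by
    change (g⁻¹ * x * g) • b = b
    rw [mul_smul, mul_smul, h2, inv_smul_smul]⟩
  rwa [mul_smul, mul_smul, inv_smul_eq_iff] at this

theorem HasFixedPoint.of_smul {G : Type*} [Group G] {V W : Type*} [MulAction G V] [MulAction G W]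
    {a b : V} (g : G)
    (h : HasFixedPoint (MulAction.stabilizer G (g • a) ⊓ MulAction.stabilizer G (g • b)) W) :
    HasFixedPoint (MulAction.stabilizer G a ⊓ MulAction.stabilizer G b) W := by
  simpa using h.smul g⁻¹

theorem stabilizer_inf_le_of_equivariant {G : Type*} [Group G] {V W : Type*} [MulAction G V]
    [MulAction G W] (f : V → W) (hf : ∀ (g : G) v, f (g • v) = g • f v) (a b : V) :
    MulAction.stabilizer G a ⊓ MulAction.stabilizer G b ≤
      MulAction.stabilizer G (f a) ⊓ MulAction.stabilizer G (f b) := fun g hg =>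
  ⟨(hf g a).symm.trans (congrArg f hg.1), (hf g b).symm.trans (congrArg f hg.2)⟩

theorem AbelianSubgroup.mono {G : Type*} [Group G] {H K : Subgroup G} (h : AbelianSubgroup K)
    (hle : H ≤ K) : AbelianSubgroup H := fun a ha b hb => h a (hle ha) b (hle hb)

theorem SlenderSubgroup.mono {G : Type*} [Group G] {H K : Subgroup G} (h : SlenderSubgroup K)
    (hle : H ≤ K) : SlenderSubgroup H := fun L hL => h L (hL.trans hle)

theorem AbelianSubgroup.stabilizer_smul {G : Type*} [Group G] {V : Type*} [MulAction G V] {a b : V}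
    (h : AbelianSubgroup (MulAction.stabilizer G a ⊓ MulAction.stabilizer G b)) (g : G) :
    AbelianSubgroup (MulAction.stabilizer G (g • a) ⊓ MulAction.stabilizer G (g • b)) := by
  have key : ∀ x ∈ MulAction.stabilizer G (g • a) ⊓ MulAction.stabilizer G (g • b),
      g⁻¹ * x * g ∈ MulAction.stabilizer G a ⊓ MulAction.stabilizer G b := by
    rintro x ⟨h1, h2⟩
    have h1 : x • g • a = g • a := h1
    have h2 : x • g • b = g • b := h2
    constructor
    · change (g⁻¹ * x * g) • a = a
      rw [mul_smul, mul_smul, h1, inv_smul_smul]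
    · change (g⁻¹ * x * g) • b = b
      rw [mul_smul, mul_smul, h2, inv_smul_smul]
  intro x hx y hy
  have h1 := h _ (key x hx) _ (key y hy)
  have h2 : g⁻¹ * (x * y) * g = g⁻¹ * (y * x) * g := by
    calc g⁻¹ * (x * y) * g = g⁻¹ * x * g * (g⁻¹ * y * g) := by group
      _ = g⁻¹ * y * g * (g⁻¹ * x * g) := h1
      _ = g⁻¹ * (y * x) * g := by group
  exact mul_left_cancel (mul_right_cancel h2)

namespace GTree

variable {G : Type u} [Group G]

theorem UnivEllipticSubgroup.mono {𝒜 : Set (Subgroup G)} {H K : Subgroup G}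
    (h : UnivEllipticSubgroup 𝒜 K) (hle : H ≤ K) : UnivEllipticSubgroup 𝒜 H := fun T hT =>
  HasFixedPoint.mono (h T hT) hle

theorem exists_resolution (hG : FinitelyPresentedGroup G) (T : GTree G) :
    ∃ T' : GTree G, T'.Dominates T ∧ ∀ a b, T'.graph.Adj a b → (T'.edgeStab a b).FG ∧
      ∃ c d, T.graph.Adj c d ∧ T'.edgeStab a b ≤ T.edgeStab c d := by
  have := hG.fg
  obtain ⟨V', _, Γ', f, hS', hfe, hf, hfg⟩ := T.isTreeAction.exists_resolution hG
  obtain ⟨T', hT', hell⟩ := hS'.exists_gtree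
  refine ⟨T', fun H hH => ((hell H).1 hH).map f hfe, fun a b hab => ?_⟩
  obtain ⟨a', b', hab', he⟩ := hT' a b hab
  rw [he]
  exact ⟨hfg a' b' hab', f a', f b', hf a' b' hab',
    stabilizer_inf_le_of_equivariant f hfe _ _⟩

/-- Separating the edges of a tree into those with abelian and those with non-abelian stabilizer. -/
theorem exists_abelian_decomposition [Group.FG G] (R : GTree G) : ∃ R₁ R₂ : GTree G,
    (∀ a b, R₁.graph.Adj a b → AbelianSubgroup (R₁.edgeStab a b)) ∧
    (∀ a b, R₂.graph.Adj a b → ¬ AbelianSubgroup (R₂.edgeStab a b) ∧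
      ∃ c d, R.graph.Adj c d ∧ R₂.edgeStab a b = R.edgeStab c d) ∧
    ∀ H, R₁.EllipticSubgroup H → R₂.EllipticSubgroup H → R.EllipticSubgroup H := by
  obtain ⟨V₁, _, Γ₁, V₂, _, Γ₂, h₁, h₂, hg₁, hg₂, hell⟩ :=
    R.isTreeAction.exists_complementary_collapses
      (fun a b => AbelianSubgroup (MulAction.stabilizer G a ⊓ MulAction.stabilizer G b))
      (fun a b h => by rwa [inf_comm]) (fun g a b h => h.stabilizer_smul g)
  obtain ⟨R₁, hR₁, he₁⟩ := h₁.exists_gtree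
  obtain ⟨R₂, hR₂, he₂⟩ := h₂.exists_gtree
  refine ⟨R₁, R₂, fun a b hab => ?_, fun a b hab => ?_, fun H h h' =>
    hell H ((he₁ H).1 h) ((he₂ H).1 h')⟩
  · obtain ⟨q, q', hq, he⟩ := hR₁ a b hab
    obtain ⟨c, d, -, hO, he'⟩ := hg₁ q q' hq
    rwa [he, he']
  · obtain ⟨q, q', hq, he⟩ := hR₂ a b hab
    obtain ⟨c, d, hcd, hO, he'⟩ := hg₂ q q' hq
    rw [he, he']
    exact ⟨hO, c, d, hcd, rfl⟩

theorem exists_blowUp_finset (hcsa : IsCSA G) [Group.FG G] (T : GTree G)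
    (hab : ∀ a b, T.graph.Adj a b → AbelianSubgroup (T.edgeStab a b)) {ι : Type*} (s : Finset ι)
    (R : ι → GTree G) (hR : ∀ i ∈ s, ∀ a b, (R i).graph.Adj a b →
      SlenderSubgroup ((R i).edgeStab a b) ∧ ¬ AbelianSubgroup ((R i).edgeStab a b)) :
    ∃ T' : GTree G, T'.Dominates T ∧ ∀ a b, T'.graph.Adj a b →
      (∃ c d, T.graph.Adj c d ∧ T'.edgeStab a b ≤ T.edgeStab c d) ∧
      ∀ i ∈ s, (R i).EllipticSubgroup (T'.edgeStab a b) := by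
  classical
  induction s using Finset.induction_on with
  | empty => exact ⟨T, fun H h => h, fun a b h => ⟨⟨a, b, h, le_rfl⟩, by simp⟩⟩
  | insert i s _ ih =>
    obtain ⟨T₁, hd₁, h₁⟩ := ih fun j hj => hR j (Finset.mem_insert_of_mem hj)
    have hab₁ : ∀ a b, T₁.graph.Adj a b → AbelianSubgroup (T₁.edgeStab a b) := by
      intro a b h
      obtain ⟨⟨c, d, hcd, hle⟩, -⟩ := h₁ a b h
      exact (hab c d hcd).mono hle
    have hRi := hR i (Finset.mem_insert_self i s)
    obtain ⟨V', _, Γ', f, hS', hfe, hf, hW⟩ := T₁.isTreeAction.exists_blowUp hcsa hab₁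
      (R i).isTreeAction (fun a b h => (hRi a b h).1) (fun a b h => (hRi a b h).2)
    obtain ⟨T', hT', hell⟩ := hS'.exists_gtree
    refine ⟨T', fun H hH => hd₁ H (((hell H).1 hH).map f hfe), fun a b h => ?_⟩
    obtain ⟨a', b', hab', he⟩ := hT' a b h
    have hle := stabilizer_inf_le_of_equivariant f hfe a' b'
    obtain ⟨⟨c, d, hcd, hle'⟩, hs⟩ := h₁ _ _ (hf a' b' hab')
    rw [he]
    refine ⟨⟨c, d, hcd, hle.trans hle'⟩, fun j hj => ?_⟩
    rcases Finset.mem_insert.1 hj with rfl | hj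
    · exact hW a' b' hab'
    · exact HasFixedPoint.mono (hs j hj) hle

/-- A tree with slender abelian edge stabilizers which are universally elliptic over abelian groups
is dominated by a JSJ tree over slender groups. -/
theorem dominates_of_freeRankLT (hG : FinitelyPresentedGroup G) (hcsa : IsCSA G) {T₀ : GTree G}
    (hJ : T₀.IsJSJ {H | SlenderSubgroup H}) (n : ℕ) (T : GTree G)
    (hab : ∀ a b, T.graph.Adj a b → AbelianSubgroup (T.edgeStab a b))
    (hsl : ∀ a b, T.graph.Adj a b → SlenderSubgroup (T.edgeStab a b))
    (hue : T.UnivEllipticTree {H | AbelianSubgroup H})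
    (hn : ∀ a b, T.graph.Adj a b →
      UnivEllipticSubgroup {H | SlenderSubgroup H} (T.edgeStab a b) ∨
        FreeRankLT n (T.edgeStab a b)) : T₀.Dominates T := by
  classical
  have := hG.fg
  induction n generalizing T with
  | zero =>
    exact hJ.2.2 T hsl fun a b h => (hn a b h).resolve_right FreeRankLT.not_zero
  | succ n ih =>
    obtain ⟨F, hF, hTF⟩ := T.exists_finite_edges
    let bad : T.V × T.V → Prop := fun p => T.graph.Adj p.1 p.2 ∧
      ¬ UnivEllipticSubgroup {H | SlenderSubgroup H} (T.edgeStab p.1 p.2)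
    have hex : ∀ p : T.V × T.V, ∃ R : GTree G, bad p →
        ¬ R.EllipticSubgroup (T.edgeStab p.1 p.2) ∧ ∀ a b, R.graph.Adj a b →
          SlenderSubgroup (R.edgeStab a b) ∧ ¬ AbelianSubgroup (R.edgeStab a b) := by
      intro p
      by_cases hp : bad p
      · have h2 := hp.2
        unfold UnivEllipticSubgroup at h2
        push Not at h2
        obtain ⟨R, hR, hRE⟩ := h2
        obtain ⟨R₁, R₂, h₁, h₂, hell⟩ := R.exists_abelian_decomposition
        refine ⟨R₂, fun _ => ⟨fun h => hRE (hell _ (hue _ _ hp.1 R₁ h₁) h), fun a b hab => ?_⟩⟩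
        obtain ⟨hna, c, d, hcd, he⟩ := h₂ a b hab
        exact ⟨by rw [he]; exact hR c d hcd, hna⟩
      · exact ⟨T, fun h => absurd h hp⟩
    choose R hR using hex
    obtain ⟨T', hd, hT'⟩ := T.exists_blowUp_finset hcsa hab ((hF.prod hF).toFinset.filter bad) R
      fun p hp => (hR p (Finset.mem_filter.1 hp).2).2
    suffices T₀.Dominates T' from fun H hH => hd H (this H hH)
    refine ih T' (fun a b h => ?_) (fun a b h => ?_) (fun a b h => ?_) (fun a b h => ?_)
    · obtain ⟨⟨c, d, hcd, hle⟩, -⟩ := hT' a b h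
      exact (hab c d hcd).mono hle
    · obtain ⟨⟨c, d, hcd, hle⟩, -⟩ := hT' a b h
      exact (hsl c d hcd).mono hle
    · obtain ⟨⟨c, d, hcd, hle⟩, -⟩ := hT' a b h
      exact UnivEllipticSubgroup.mono (hue c d hcd) hle
    · obtain ⟨⟨c, d, hcd, hle⟩, hs⟩ := hT' a b h
      rcases hn c d hcd with hu | hr
      · exact Or.inl (hu.mono hle)
      by_cases hu : UnivEllipticSubgroup {H | SlenderSubgroup H} (T.edgeStab c d)
      · exact Or.inl (hu.mono hle)
      right
      obtain ⟨g, hgc, hgd⟩ := hTF c d hcd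
      have hbad : bad (g • c, g • d) := ⟨T.act_adj g c d hcd, fun hu' =>
        hu fun R hR => HasFixedPoint.of_smul g (hu' R hR)⟩
      have hp : (g • c, g • d) ∈ (hF.prod hF).toFinset.filter bad :=
        Finset.mem_filter.2 ⟨(Set.Finite.mem_toFinset _).2 ⟨hgc, hgd⟩, hbad⟩
      exact FreeRankLT.of_elliptic (R (g • c, g • d)).isTreeAction hr (hab c d hcd)
        (hsl c d hcd _ le_rfl) (fun h => (hR _ hbad).1 (HasFixedPoint.smul h g)) hle (hs _ hp)

end GTree

namespace GTree

variable {G : Type u} [Group G]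

theorem exists_uniform_freeRankLT [Group.FG G] (T : GTree G)
    (hab : ∀ a b, T.graph.Adj a b → AbelianSubgroup (T.edgeStab a b))
    (hfg : ∀ a b, T.graph.Adj a b → (T.edgeStab a b).FG) :
    ∃ n, ∀ a b, T.graph.Adj a b → FreeRankLT n (T.edgeStab a b) := by
  classical
  obtain ⟨F, hF, hTF⟩ := T.exists_finite_edges
  have hex : ∀ p : T.V × T.V, ∃ n, T.graph.Adj p.1 p.2 → FreeRankLT n (T.edgeStab p.1 p.2) := by
    intro p
    by_cases hp : T.graph.Adj p.1 p.2
    · obtain ⟨n, hn⟩ := (hab _ _ hp).exists_freeRankLT (hfg _ _ hp)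
      exact ⟨n, fun _ => hn⟩
    · exact ⟨0, fun h => absurd h hp⟩
  choose m hm using hex
  refine ⟨(hF.prod hF).toFinset.sup m, fun a b h => ?_⟩
  obtain ⟨g, hga, hgb⟩ := hTF a b h
  have hp : (g • a, g • b) ∈ (hF.prod hF).toFinset := (Set.Finite.mem_toFinset _).2 ⟨hga, hgb⟩
  refine ((hm (g • a, g • b) (T.act_adj g a b h)).mono
    (Finset.le_sup (f := m) hp)).of_conj g ?_
  rintro x ⟨h1, h2⟩
  have h1 : x • a = a := h1
  have h2 : x • b = b := h2
  constructor
  · change (g * x * g⁻¹) • g • a = g • a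
    rw [mul_smul, mul_smul, inv_smul_smul, h1]
  · change (g * x * g⁻¹) • g • b = g • b
    rw [mul_smul, mul_smul, inv_smul_smul, h2]

/-- Edges of a collapse come from edges with at least the same stabilizer. -/
theorem IsCollapseMap.exists_edge {T T' : GTree G} {π : T.V → T'.V} (hπ : IsCollapseMap T T' π)
    {q q' : T'.V} (hq : T'.graph.Adj q q') : ∃ u v, T.graph.Adj u v ∧ π u = q ∧ π v = q' ∧
      T'.edgeStab q q' ≤ T.edgeStab u v := by
  obtain ⟨heq, hsurj, hadj, hconn⟩ := hπ
  have hT := T.isTreeAction.isTree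
  have hT' := T'.isTreeAction.isTree
  obtain ⟨a, rfl⟩ := hsurj q
  obtain ⟨b, rfl⟩ := hsurj q'
  obtain ⟨u, v, huv, hu, hv⟩ := (T.connected.preconnected a b).exists_adj_crossing
    (fun x => T'.graph.dist (π x) (π a) < T'.graph.dist (π x) (π b))
    (by rw [SimpleGraph.dist_eq_one_iff_adj.2 hq, SimpleGraph.dist_self]; exact one_pos)
    (by rw [SimpleGraph.dist_self]; exact Nat.not_lt_zero _)
  have hne : T'.graph.Adj (π u) (π v) := (hadj u v huv).resolve_left fun h => hv (h ▸ hu)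
  obtain ⟨hua, hvb⟩ := hT'.eq_of_side hq hne hu hv
  refine ⟨u, v, huv, hua, hvb, ?_⟩
  have side : ∀ q, (π u = q → π v ≠ q) → ∀ x y, π x = q → π y = q →
      T.graph.dist x u < T.graph.dist x v → T.graph.dist y u < T.graph.dist y v := by
    intro q hquv x y hx hy hxu
    by_contra hyu
    obtain ⟨⟨s, hs⟩, ⟨t, ht⟩, hst, h1, h2⟩ :=
      ((hconn q).preconnected ⟨x, hx⟩ ⟨y, hy⟩).exists_adj_crossing
        (fun z => T.graph.dist z.1 u < T.graph.dist z.1 v) hxu hyu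
    obtain ⟨rfl, rfl⟩ := hT.eq_of_side huv hst h1 h2
    exact hquv hs ht
  rintro g ⟨h1, h2⟩
  have e1 : π (g • u) = π a := (heq g u).trans ((congrArg (T'.act g) hua).trans h1)
  have e2 : π (g • v) = π b := (heq g v).trans ((congrArg (T'.act g) hvb).trans h2)
  have h3 := side (π a) (fun _ h => hq.ne (h.symm.trans hvb)) u (g • u) hua e1
    (by rw [SimpleGraph.dist_eq_one_iff_adj.2 huv, SimpleGraph.dist_self]; exact one_pos)
  have h4 : ¬ T.graph.dist (g • v) u < T.graph.dist (g • v) v := fun h => by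
    have := side (π b) (fun h _ => hq.ne (hua.symm.trans h)) (g • v) v e2 hvb h
    rw [SimpleGraph.dist_self] at this
    exact Nat.not_lt_zero _ this
  exact hT.eq_of_side huv (T.act_adj g u v huv) h3 h4

/-- A domination passes to the collapse of the edges with non-abelian stabilizer, if the target has
abelian edge stabilizers. -/
theorem IsCollapseMap.dominates {T T' S : GTree G} {π : T.V → T'.V} (hπ : IsCollapseMap T T' π)
    (hcoll : ∀ a b, T.graph.Adj a b → π a = π b → ¬ AbelianSubgroup (T.edgeStab a b))
    (hS : ∀ a b, S.graph.Adj a b → AbelianSubgroup (S.edgeStab a b)) (hd : T.Dominates S) :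
    T'.Dominates S := by
  classical
  obtain ⟨heq, hsurj, -, hconn⟩ := hπ
  have hT := T.isTreeAction.isTree
  rintro H ⟨w, hw⟩
  have hinv : ∀ h ∈ H, ∀ y, π y = w → π (h • y) = w := fun h hh y hy =>
    (heq h y).trans ((congrArg (T'.act h) hy).trans (hw h hh))
  have hconv := hT.geodConvex_of_connected (hconn w)
  obtain ⟨y₀, hy₀⟩ := hsurj w
  by_cases hsub : ∀ y, π y = w → y = y₀
  · exact hd H ⟨y₀, fun h hh => hsub _ (hinv h hh y₀ hy₀)⟩
  push Not at hsub
  obtain ⟨y₁, hy₁, hne⟩ := hsub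
  have hnbr : ∀ y, π y = w → ∃ z, T.graph.Adj y z ∧ π z = w := by
    intro y hy
    obtain ⟨y', hy', hne'⟩ : ∃ y', π y' = w ∧ y ≠ y' := by
      by_cases h : y = y₀
      · exact ⟨y₁, hy₁, fun h' => hne (h'.symm.trans h)⟩
      · exact ⟨y₀, hy₀, h⟩
    obtain ⟨z, hz, hd⟩ := hT.exists_first_edge hne'
    have := SimpleGraph.dist_eq_one_iff_adj.2 hz
    exact ⟨z, hz, hconv y hy y' hy' z (by omega)⟩
  have hna : ∀ y, π y = w → ¬ AbelianSubgroup (MulAction.stabilizer G y) := by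
    intro y hy hab
    obtain ⟨z, hz, hzw⟩ := hnbr y hy
    exact hcoll y z hz (hy.trans hzw.symm) (hab.mono inf_le_left)
  have hfix : ∀ y : T.V, ∃ s : S.V, ∀ g ∈ MulAction.stabilizer G y, g • s = s := fun y =>
    hd (MulAction.stabilizer G y) ⟨y, fun g hg => hg⟩
  choose p hp using hfix
  have hconst : ∀ y, π y = w → p y = p y₀ := by
    intro y hy
    by_contra hpy
    obtain ⟨⟨s, hs⟩, ⟨t, ht⟩, hst, h1, h2⟩ :=
      ((hconn w).preconnected ⟨y₀, hy₀⟩ ⟨y, hy⟩).exists_adj_crossing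
        (fun z => p z.1 = p y₀) rfl hpy
    have h3 := S.isTreeAction.fixed_unique hS (hcoll s t hst (hs.trans ht.symm))
      (fun g hg => hp s g hg.1) (fun g hg => hp t g hg.2)
    exact h2 (h3.symm.trans h1)
  refine ⟨p y₀, fun h hh => ?_⟩
  have hy := hinv h hh y₀ hy₀
  have h3 := S.isTreeAction.fixed_unique hS (hna _ hy) (s := h • p y₀) (t := p (h • y₀))
    (fun g hg => by
      have hg : g • h • y₀ = h • y₀ := hg
      have := hp y₀ (h⁻¹ * g * h) (by
        change (h⁻¹ * g * h) • y₀ = y₀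
        rw [mul_smul, mul_smul, hg, inv_smul_smul])
      rwa [mul_smul, mul_smul, inv_smul_eq_iff] at this) (hp _)
  exact h3.trans (hconst _ hy)

end GTree

/-- for a torsion-free finitely presented CSA group, collapsing the edges
with non-abelian stabilizer in a slender JSJ tree yields an abelian JSJ tree. -/
theorem csa_abelian_jsj {G : Type u} [Group G]
    (htf : ∀ g : G, g ≠ 1 → ¬IsOfFinOrder g)
    (hfp : FinitelyPresentedGroup G) (hcsa : IsCSA G)
    (Ts : GTree G) (hTs : Ts.IsJSJ {H : Subgroup G | SlenderSubgroup H})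
    (T : GTree G) (π : Ts.V → T.V) (hπ : GTree.IsCollapseMap Ts T π)
    (hcoll : ∀ a b : Ts.V, Ts.graph.Adj a b →
      (π a = π b ↔ ¬AbelianSubgroup (Ts.edgeStab a b))) :
    T.IsJSJ {H : Subgroup G | AbelianSubgroup H} := by
  have := hfp.fg
  refine ⟨fun a b hab => ?_, fun a b hab S hS => ?_, fun S hS hue => ?_⟩
  · obtain ⟨u, v, huv, hu, hv, hle⟩ := hπ.exists_edge hab
    have h : AbelianSubgroup (Ts.edgeStab u v) := by
      by_contra h
      exact hab.ne (hu.symm.trans (((hcoll u v huv).2 h).trans hv))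
    exact h.mono hle
  · obtain ⟨u, v, huv, -, -, hle⟩ := hπ.exists_edge hab
    obtain ⟨S', hd, hS'⟩ := S.exists_resolution hfp
    refine HasFixedPoint.mono (hd _ (hTs.2.1 u v huv S' fun c d hcd => ?_)) hle
    obtain ⟨hfg, c', d', hcd', hle'⟩ := hS' c d hcd
    exact AbelianSubgroup.slender ((hS c' d' hcd').mono hle') hfg
  · obtain ⟨S', hd, hS'⟩ := S.exists_resolution hfp
    have hab' : ∀ c d, S'.graph.Adj c d → AbelianSubgroup (S'.edgeStab c d) := fun c d hcd => by
      obtain ⟨-, c', d', hcd', hle'⟩ := hS' c d hcd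
      exact AbelianSubgroup.mono (hS c' d' hcd') hle'
    obtain ⟨n, hn⟩ := S'.exists_uniform_freeRankLT hab' fun c d hcd => (hS' c d hcd).1
    have hdom := GTree.dominates_of_freeRankLT hfp hcsa hTs n S' hab'
      (fun c d hcd => (hab' c d hcd).slender (hS' c d hcd).1)
      (fun c d hcd => by
        obtain ⟨-, c', d', hcd', hle'⟩ := hS' c d hcd
        exact GTree.UnivEllipticSubgroup.mono (hue c' d' hcd') hle')
      (fun c d hcd => Or.inr (hn c d hcd))
    exact hπ.dominates (fun a b h => (hcoll a b h).1) hS fun H hH => hd H (hdom H hH)
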